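/- arXiv:0804.4882 — 11 statements merged into one kernel-verified Lean document; each statement's English description precedes it below -/
import Mathlib

section
/- Let L = U ⊕ A₂ and set v₁ = u₁ + u₂, v₂ = a₂, v₃ = a₁ − a₂, v₄ = −(u₂ + a₁ + a₂). Then every isometry f of L with f({v₁, v₂, v₃, v₄}) = {v₁, v₂, v₃, v₄} is the identity. (These four vectors are the wall normals of the Vinberg fundamental polyhedron of U ⊕ A₂; the absence of nontrivial symmetries underlies the chirality of the corresponding class of M-cubics.) -/
open Matrix

namespace Stmt0

/-- Gram matrix of the lattice. -/
def G : Matrix (Fin 4) (Fin 4) ℤ :=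
  !![0, 1, 0, 0;
    1, 0, 0, 0;
    0, 0, 2, -1;
    0, 0, -1, 2]

/-- The bilinear form of the lattice. -/
def B (x y : Fin 4 → ℤ) : ℤ := x ⬝ᵥ G.mulVec y

def v1 : Fin 4 → ℤ := ![1, 1, 0, 0]

def v2 : Fin 4 → ℤ := ![0, 0, 0, 1]

def v3 : Fin 4 → ℤ := ![0, 0, 1, -1]

def v4 : Fin 4 → ℤ := ![0, -1, -1, -1]

/-- The wall normals form a basis; this is the expansion of a vector in it. -/
theorem eq_sum_wall_normals (x : Fin 4 → ℤ) :
    x = x 0 • v1 + (x 3 + x 2 + 2 * (x 0 - x 1)) • v2 + (x 2 + x 0 - x 1) • v3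
      + (x 0 - x 1) • v4 := by
  ext i
  fin_cases i <;> simp [v1, v2, v3, v4]
  ring

/-- Every isometry of `U ⊕ A₂` preserving the set of wall normals
`{v₁, v₂, v₃, v₄}` of the Vinberg fundamental polyhedron is the identity. -/
theorem no_symmetry (f : (Fin 4 → ℤ) ≃ₗ[ℤ] (Fin 4 → ℤ))
    (hB : ∀ x y, B (f x) (f y) = B x y)
    (hS : ⇑f '' ({v1, v2, v3, v4} : Set (Fin 4 → ℤ)) = {v1, v2, v3, v4}) :
    ∀ x, f x = x := by
  have hmem : ∀ v ∈ ({v1, v2, v3, v4} : Set (Fin 4 → ℤ)),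
      f v = v1 ∨ f v = v2 ∨ f v = v3 ∨ f v = v4 := fun v hv => by
    have h := hS ▸ Set.mem_image_of_mem f hv
    simpa using h
  have h3 : f v3 = v3 := by
    have h := hB v3 v3
    rcases hmem v3 (by simp) with e | e | e | e <;> rw [e] at h
    all_goals first | exact e | exact absurd h (by decide)
  have h2 : f v2 = v2 := by
    have h := hB v2 v3
    rw [h3] at h
    rcases hmem v2 (by simp) with e | e | e | e <;> rw [e] at h
    all_goals first | exact e | exact absurd h (by decide)
  have h4 : f v4 = v4 := by
    have h := hB v4 v2
    rw [h2] at h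
    rcases hmem v4 (by simp) with e | e | e | e <;> rw [e] at h
    all_goals first | exact e | exact absurd h (by decide)
  have h1 : f v1 = v1 := by
    have h := hB v1 v2
    rw [h2] at h
    rcases hmem v1 (by simp) with e | e | e | e <;> rw [e] at h
    all_goals first | exact e | exact absurd h (by decide)
  intro x
  rw [eq_sum_wall_normals x]
  simp only [map_add, map_smul, h1, h2, h3, h4]

end Stmt0
end

section
/- Let L = U ⊕ A₂ ⊕ E₈ and set v₁ = u₁ + u₂, v₂ = a₂, v₃ = a₁ − a₂, v₄ = −(u₂ + a₁ + a₂), v₅ = −u₂ − e₈*. Then every isometry f of L with f(S) = S, where S = {e₁, …, e₈, v₁, v₂, v₃, v₄, v₅}, is the identity. (These thirteen vectors are the wall normals of the Vinberg fundamental polyhedron of U ⊕ A₂ ⊕ E₈; the absence of nontrivial symmetries underlies the chirality of the corresponding class of M-cubics.) -/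
open Matrix

namespace Stmt1

/-- Gram matrix of the lattice. -/
def G : Matrix (Fin 12) (Fin 12) ℤ :=
  !![0, 1, 0, 0, 0, 0, 0, 0, 0, 0, 0, 0;
    1, 0, 0, 0, 0, 0, 0, 0, 0, 0, 0, 0;
    0, 0, 2, -1, 0, 0, 0, 0, 0, 0, 0, 0;
    0, 0, -1, 2, 0, 0, 0, 0, 0, 0, 0, 0;
    0, 0, 0, 0, 2, 0, -1, 0, 0, 0, 0, 0;
    0, 0, 0, 0, 0, 2, 0, -1, 0, 0, 0, 0;
    0, 0, 0, 0, -1, 0, 2, -1, 0, 0, 0, 0;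
    0, 0, 0, 0, 0, -1, -1, 2, -1, 0, 0, 0;
    0, 0, 0, 0, 0, 0, 0, -1, 2, -1, 0, 0;
    0, 0, 0, 0, 0, 0, 0, 0, -1, 2, -1, 0;
    0, 0, 0, 0, 0, 0, 0, 0, 0, -1, 2, -1;
    0, 0, 0, 0, 0, 0, 0, 0, 0, 0, -1, 2]

/-- The bilinear form of the lattice. -/
def B (x y : Fin 12 → ℤ) : ℤ := x ⬝ᵥ G.mulVec y

def e1 : Fin 12 → ℤ := ![0, 0, 0, 0, 1, 0, 0, 0, 0, 0, 0, 0]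

def e2 : Fin 12 → ℤ := ![0, 0, 0, 0, 0, 1, 0, 0, 0, 0, 0, 0]

def e3 : Fin 12 → ℤ := ![0, 0, 0, 0, 0, 0, 1, 0, 0, 0, 0, 0]

def e4 : Fin 12 → ℤ := ![0, 0, 0, 0, 0, 0, 0, 1, 0, 0, 0, 0]

def e5 : Fin 12 → ℤ := ![0, 0, 0, 0, 0, 0, 0, 0, 1, 0, 0, 0]

def e6 : Fin 12 → ℤ := ![0, 0, 0, 0, 0, 0, 0, 0, 0, 1, 0, 0]

def e7 : Fin 12 → ℤ := ![0, 0, 0, 0, 0, 0, 0, 0, 0, 0, 1, 0]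

def e8 : Fin 12 → ℤ := ![0, 0, 0, 0, 0, 0, 0, 0, 0, 0, 0, 1]

def v1 : Fin 12 → ℤ := ![1, 1, 0, 0, 0, 0, 0, 0, 0, 0, 0, 0]

def v2 : Fin 12 → ℤ := ![0, 0, 0, 1, 0, 0, 0, 0, 0, 0, 0, 0]

def v3 : Fin 12 → ℤ := ![0, 0, 1, -1, 0, 0, 0, 0, 0, 0, 0, 0]

def v4 : Fin 12 → ℤ := ![0, -1, -1, -1, 0, 0, 0, 0, 0, 0, 0, 0]

def v5 : Fin 12 → ℤ := ![0, -1, 0, 0, -2, -3, -4, -6, -5, -4, -3, -2]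

/-- The thirteen wall normals, listed along the Coxeter diagram starting from the one of norm 6. -/
def wall : Fin 13 → Fin 12 → ℤ :=
  ![v3, v2, v4, v1, v5, e8, e7, e6, e5, e4, e3, e1, e2]

/-- Gram matrix of the wall normals. -/
def wallGram : Fin 13 → Fin 13 → ℤ :=
  ![![6, -3, 0, 0, 0, 0, 0, 0, 0, 0, 0, 0, 0],
    ![-3, 2, -1, 0, 0, 0, 0, 0, 0, 0, 0, 0, 0],
    ![0, -1, 2, -1, 0, 0, 0, 0, 0, 0, 0, 0, 0],
    ![0, 0, -1, 2, -1, 0, 0, 0, 0, 0, 0, 0, 0],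
    ![0, 0, 0, -1, 2, -1, 0, 0, 0, 0, 0, 0, 0],
    ![0, 0, 0, 0, -1, 2, -1, 0, 0, 0, 0, 0, 0],
    ![0, 0, 0, 0, 0, -1, 2, -1, 0, 0, 0, 0, 0],
    ![0, 0, 0, 0, 0, 0, -1, 2, -1, 0, 0, 0, 0],
    ![0, 0, 0, 0, 0, 0, 0, -1, 2, -1, 0, 0, 0],
    ![0, 0, 0, 0, 0, 0, 0, 0, -1, 2, -1, 0, -1],
    ![0, 0, 0, 0, 0, 0, 0, 0, 0, -1, 2, -1, 0],
    ![0, 0, 0, 0, 0, 0, 0, 0, 0, 0, -1, 2, 0],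
    ![0, 0, 0, 0, 0, 0, 0, 0, 0, -1, 0, 0, 2]]

lemma B_wall (i j : Fin 13) : B (wall i) (wall j) = wallGram i j := by
  revert i j
  decide +kernel

lemma range_wall :
    Set.range wall = {e1, e2, e3, e4, e5, e6, e7, e8, v1, v2, v3, v4, v5} := by
  ext x
  simp only [wall, Matrix.range_cons, Matrix.range_empty, Set.union_empty, Set.mem_union,
    Set.mem_insert_iff, Set.mem_singleton_iff]
  grind

/-- Except for `e3`, which is preceded by a branch point of the diagram, each wall normal is
determined by its norm and its products with the preceding ones. -/
lemma eq_of_wallGram_eq : ∀ k m : Fin 13, k ≠ 10 →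
    (∀ j < k, wallGram m j = wallGram k j) → wallGram m m = wallGram k k → m = k := by
  decide +kernel

/-- The wall normal `e3` is the only neighbour of `e4` orthogonal to `e5` that has a
neighbour orthogonal to `e4`. -/
lemma eq_ten_of_wallGram_eq : ∀ m n : Fin 13, wallGram m 9 = -1 → wallGram m 8 = 0 →
    wallGram m n = -1 → wallGram n 9 = 0 → m = 10 := by
  decide +kernel

lemma eq_self_of_wallGram_comp_eq (σ : Fin 13 → Fin 13)
    (h : ∀ i j, wallGram (σ i) (σ j) = wallGram i j) (k : Fin 13) : σ k = k := by
  induction k using WellFoundedLT.induction with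
  | _ k ih =>
    by_cases hk : k = 10
    · subst hk
      have h8 : σ 8 = 8 := ih 8 (by decide)
      have h9 : σ 9 = 9 := ih 9 (by decide)
      refine eq_ten_of_wallGram_eq (σ 10) (σ 11) ?_ ?_ ?_ ?_
      · rw [← h9, h]; rfl
      · rw [← h8, h]; rfl
      · rw [h]; rfl
      · rw [← h9, h]; rfl
    · refine eq_of_wallGram_eq k (σ k) hk (fun j hj => ?_) (h k k)
      rw [← h k j, ih j hj]

lemma eq_self_of_apply_wall_eq (f : (Fin 12 → ℤ) →ₗ[ℤ] (Fin 12 → ℤ))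
    (h : ∀ i, f (wall i) = wall i) (x : Fin 12 → ℤ) : f x = x := by
  have hx : x = x 0 • (wall 3 + wall 2 + wall 0 + (2 : ℤ) • wall 1)
      - x 1 • (wall 2 + wall 0 + (2 : ℤ) • wall 1)
      + x 2 • (wall 0 + wall 1) + x 3 • wall 1
      + x 4 • wall 11 + x 5 • wall 12 + x 6 • wall 10 + x 7 • wall 9
      + x 8 • wall 8 + x 9 • wall 7 + x 10 • wall 6 + x 11 • wall 5 := by
    ext i
    fin_cases i <;>
      simp [wall, e1, e2, e3, e4, e5, e6, e7, e8, v1, v2, v3, v4, v5]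
  rw [hx]
  simp only [map_add, map_sub, map_smul, h]

/-- Every isometry of `U ⊕ A₂ ⊕ E₈` preserving the set of the thirteen wall
normals of the Vinberg fundamental polyhedron is the identity. -/
theorem no_symmetry (f : (Fin 12 → ℤ) ≃ₗ[ℤ] (Fin 12 → ℤ))
    (hB : ∀ x y, B (f x) (f y) = B x y)
    (hS : ⇑f '' ({e1, e2, e3, e4, e5, e6, e7, e8,
      v1, v2, v3, v4, v5} : Set (Fin 12 → ℤ)) =
      {e1, e2, e3, e4, e5, e6, e7, e8, v1, v2, v3, v4, v5}) :
    ∀ x, f x = x := by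
  rw [← range_wall] at hS
  have hf (i : Fin 13) : ∃ j, wall j = f (wall i) :=
    hS.subset (Set.mem_image_of_mem f (Set.mem_range_self i))
  choose σ hσ using hf
  have hG (i j : Fin 13) : wallGram (σ i) (σ j) = wallGram i j := by
    rw [← B_wall, ← B_wall, hσ, hσ, hB]
  refine eq_self_of_apply_wall_eq f.toLinearMap fun i => ?_
  simpa [eq_self_of_wallGram_comp_eq σ hG i] using (hσ i).symm

end Stmt1
end

section
/- Let L = U ⊕ A₂ ⊕ E₈ ⊕ E₈ and let S be the 24-element set consisting of e₁, …, e₈, e₁', …, e₈', v₁ = u₁+u₂, v₂ = a₂, v₄ = −(u₂+a₁+a₂), v₅ = −u₂−e₈*, v₅' = −u₂−(e₈')*, v₆ = 2(u₁−u₂)−a₁−a₂−e₁*−(e₁')*, v₇ = 3(u₁−u₂)−2a₁−a₂−e₇*−(e₂')*, and v₇' = 3(u₁−u₂)−2a₁−a₂−e₂*−(e₇')*. Set v₃ = a₁−a₂ and v₈' = 6(u₁−u₂)−4a₁−2a₂−3e₁*−3(e₈')*. Then there exists an isometry f of L with f ∘ f = id such that f(S) = S, f(e₇) = e₇, f(e₇')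 = e₇', f(e₄') = e₄', f(v₆) = v₆, f(v₁) = e₄, f(v₃) = v₈', and v₃ + v₈' ∈ 3L. (This ℤ/3-reversing involution preserving the Vinberg fundamental polyhedron witnesses the achirality of the M-cubics of type U + A₂ + 2E₈.) -/
open Matrix

namespace Stmt2

/-- Gram matrix of the lattice. -/
def G : Matrix (Fin 20) (Fin 20) ℤ :=
  !![0, 1, 0, 0, 0, 0, 0, 0, 0, 0, 0, 0, 0, 0, 0, 0, 0, 0, 0, 0;
    1, 0, 0, 0, 0, 0, 0, 0, 0, 0, 0, 0, 0, 0, 0, 0, 0, 0, 0, 0;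
    0, 0, 2, -1, 0, 0, 0, 0, 0, 0, 0, 0, 0, 0, 0, 0, 0, 0, 0, 0;
    0, 0, -1, 2, 0, 0, 0, 0, 0, 0, 0, 0, 0, 0, 0, 0, 0, 0, 0, 0;
    0, 0, 0, 0, 2, 0, -1, 0, 0, 0, 0, 0, 0, 0, 0, 0, 0, 0, 0, 0;
    0, 0, 0, 0, 0, 2, 0, -1, 0, 0, 0, 0, 0, 0, 0, 0, 0, 0, 0, 0;
    0, 0, 0, 0, -1, 0, 2, -1, 0, 0, 0, 0, 0, 0, 0, 0, 0, 0, 0, 0;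
    0, 0, 0, 0, 0, -1, -1, 2, -1, 0, 0, 0, 0, 0, 0, 0, 0, 0, 0, 0;
    0, 0, 0, 0, 0, 0, 0, -1, 2, -1, 0, 0, 0, 0, 0, 0, 0, 0, 0, 0;
    0, 0, 0, 0, 0, 0, 0, 0, -1, 2, -1, 0, 0, 0, 0, 0, 0, 0, 0, 0;
    0, 0, 0, 0, 0, 0, 0, 0, 0, -1, 2, -1, 0, 0, 0, 0, 0, 0, 0, 0;
    0, 0, 0, 0, 0, 0, 0, 0, 0, 0, -1, 2, 0, 0, 0, 0, 0, 0, 0, 0;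
    0, 0, 0, 0, 0, 0, 0, 0, 0, 0, 0, 0, 2, 0, -1, 0, 0, 0, 0, 0;
    0, 0, 0, 0, 0, 0, 0, 0, 0, 0, 0, 0, 0, 2, 0, -1, 0, 0, 0, 0;
    0, 0, 0, 0, 0, 0, 0, 0, 0, 0, 0, 0, -1, 0, 2, -1, 0, 0, 0, 0;
    0, 0, 0, 0, 0, 0, 0, 0, 0, 0, 0, 0, 0, -1, -1, 2, -1, 0, 0, 0;
    0, 0, 0, 0, 0, 0, 0, 0, 0, 0, 0, 0, 0, 0, 0, -1, 2, -1, 0, 0;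
    0, 0, 0, 0, 0, 0, 0, 0, 0, 0, 0, 0, 0, 0, 0, 0, -1, 2, -1, 0;
    0, 0, 0, 0, 0, 0, 0, 0, 0, 0, 0, 0, 0, 0, 0, 0, 0, -1, 2, -1;
    0, 0, 0, 0, 0, 0, 0, 0, 0, 0, 0, 0, 0, 0, 0, 0, 0, 0, -1, 2]

/-- The bilinear form of the lattice. -/
def B (x y : Fin 20 → ℤ) : ℤ := x ⬝ᵥ G.mulVec y

def e1 : Fin 20 → ℤ := ![0, 0, 0, 0, 1, 0, 0, 0, 0, 0, 0, 0, 0, 0, 0, 0, 0, 0, 0, 0]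

def e1' : Fin 20 → ℤ := ![0, 0, 0, 0, 0, 0, 0, 0, 0, 0, 0, 0, 1, 0, 0, 0, 0, 0, 0, 0]

def e2 : Fin 20 → ℤ := ![0, 0, 0, 0, 0, 1, 0, 0, 0, 0, 0, 0, 0, 0, 0, 0, 0, 0, 0, 0]

def e2' : Fin 20 → ℤ := ![0, 0, 0, 0, 0, 0, 0, 0, 0, 0, 0, 0, 0, 1, 0, 0, 0, 0, 0, 0]

def e3 : Fin 20 → ℤ := ![0, 0, 0, 0, 0, 0, 1, 0, 0, 0, 0, 0, 0, 0, 0, 0, 0, 0, 0, 0]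

def e3' : Fin 20 → ℤ := ![0, 0, 0, 0, 0, 0, 0, 0, 0, 0, 0, 0, 0, 0, 1, 0, 0, 0, 0, 0]

def e4 : Fin 20 → ℤ := ![0, 0, 0, 0, 0, 0, 0, 1, 0, 0, 0, 0, 0, 0, 0, 0, 0, 0, 0, 0]

def e4' : Fin 20 → ℤ := ![0, 0, 0, 0, 0, 0, 0, 0, 0, 0, 0, 0, 0, 0, 0, 1, 0, 0, 0, 0]

def e5 : Fin 20 → ℤ := ![0, 0, 0, 0, 0, 0, 0, 0, 1, 0, 0, 0, 0, 0, 0, 0, 0, 0, 0, 0]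

def e5' : Fin 20 → ℤ := ![0, 0, 0, 0, 0, 0, 0, 0, 0, 0, 0, 0, 0, 0, 0, 0, 1, 0, 0, 0]

def e6 : Fin 20 → ℤ := ![0, 0, 0, 0, 0, 0, 0, 0, 0, 1, 0, 0, 0, 0, 0, 0, 0, 0, 0, 0]

def e6' : Fin 20 → ℤ := ![0, 0, 0, 0, 0, 0, 0, 0, 0, 0, 0, 0, 0, 0, 0, 0, 0, 1, 0, 0]

def e7 : Fin 20 → ℤ := ![0, 0, 0, 0, 0, 0, 0, 0, 0, 0, 1, 0, 0, 0, 0, 0, 0, 0, 0, 0]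

def e7' : Fin 20 → ℤ := ![0, 0, 0, 0, 0, 0, 0, 0, 0, 0, 0, 0, 0, 0, 0, 0, 0, 0, 1, 0]

def e8 : Fin 20 → ℤ := ![0, 0, 0, 0, 0, 0, 0, 0, 0, 0, 0, 1, 0, 0, 0, 0, 0, 0, 0, 0]

def e8' : Fin 20 → ℤ := ![0, 0, 0, 0, 0, 0, 0, 0, 0, 0, 0, 0, 0, 0, 0, 0, 0, 0, 0, 1]

def v1 : Fin 20 → ℤ := ![1, 1, 0, 0, 0, 0, 0, 0, 0, 0, 0, 0, 0, 0, 0, 0, 0, 0, 0, 0]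

def v2 : Fin 20 → ℤ := ![0, 0, 0, 1, 0, 0, 0, 0, 0, 0, 0, 0, 0, 0, 0, 0, 0, 0, 0, 0]

def v3 : Fin 20 → ℤ := ![0, 0, 1, -1, 0, 0, 0, 0, 0, 0, 0, 0, 0, 0, 0, 0, 0, 0, 0, 0]

def v4 : Fin 20 → ℤ := ![0, -1, -1, -1, 0, 0, 0, 0, 0, 0, 0, 0, 0, 0, 0, 0, 0, 0, 0, 0]

def v5 : Fin 20 → ℤ := ![0, -1, 0, 0, -2, -3, -4, -6, -5, -4, -3, -2, 0, 0, 0, 0, 0, 0, 0, 0]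

def v5' : Fin 20 → ℤ := ![0, -1, 0, 0, 0, 0, 0, 0, 0, 0, 0, 0, -2, -3, -4, -6, -5, -4, -3, -2]

def v6 : Fin 20 → ℤ := ![2, -2, -1, -1, -4, -5, -7, -10, -8, -6, -4, -2, -4, -5, -7, -10, -8, -6, -4, -2]

def v7 : Fin 20 → ℤ := ![3, -3, -2, -1, -4, -6, -8, -12, -10, -8, -6, -3, -5, -8, -10, -15, -12, -9, -6, -3]

def v7' : Fin 20 → ℤ := ![3, -3, -2, -1, -5, -8, -10, -15, -12, -9, -6, -3, -4, -6, -8, -12, -10, -8, -6, -3]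

def v8' : Fin 20 → ℤ := ![6, -6, -4, -2, -12, -15, -21, -30, -24, -18, -12, -6, -6, -9, -12, -18, -15, -12, -9, -6]

/-- Matrix of the reversing involution. -/
def T : Matrix (Fin 20) (Fin 20) ℤ :=
  !![6, -6, 6, 0, 0, 0, 0, 1, 0, 0, 0, 0, 0, 0, 0, 0, 0, 0, 0, 3;
    -6, 6, -6, 0, 0, -1, -1, 1, -1, 0, 0, 0, 0, 0, 0, 0, 0, 0, 0, -3;
    -4, 4, -4, 0, 0, 0, -1, 0, 0, 0, 0, 0, 0, 0, 0, 0, 0, 0, 0, -2;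
    -2, 2, -2, 0, 1, 0, -1, 0, 0, 0, 0, 0, 0, 0, 0, 0, 0, 0, 0, -1;
    -10, 10, -11, 1, 0, 0, 0, 0, -2, 0, 0, 0, 0, 0, 0, 0, 0, 0, 0, -5;
    -15, 15, -15, 0, 0, 0, 0, 0, -3, 0, 0, 0, 0, 0, 0, 0, 0, 0, 0, -8;
    -20, 20, -21, 0, 0, 0, 0, 0, -4, 0, 0, 0, 0, 0, 0, 0, 0, 0, 0, -10;
    -29, 30, -30, 0, 0, 0, 0, 0, -6, 0, 0, 0, 0, 0, 0, 0, 0, 0, 0, -15;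
    -24, 24, -24, 0, 0, 0, 0, 0, -5, 0, 0, 0, 0, 0, 0, 0, 0, 0, 0, -12;
    -18, 18, -18, 0, 0, 0, 0, 0, -4, 0, 0, 1, 0, 0, 0, 0, 0, 0, 0, -9;
    -12, 12, -12, 0, 0, 0, 0, 0, -3, 0, 1, 0, 0, 0, 0, 0, 0, 0, 0, -6;
    -6, 6, -6, 0, 0, 0, 0, 0, -2, 1, 0, 0, 0, 0, 0, 0, 0, 0, 0, -3;
    -6, 6, -6, 0, 0, -2, 0, 0, 0, 0, 0, 0, 1, 0, 0, 0, 0, 0, 0, -4;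
    -9, 9, -9, 0, 0, -3, 0, 0, 0, 0, 0, 0, 0, 1, 0, 0, 0, 0, 0, -6;
    -12, 12, -12, 0, 0, -4, 0, 0, 0, 0, 0, 0, 0, 0, 1, 0, 0, 0, 0, -8;
    -18, 18, -18, 0, 0, -6, 0, 0, 0, 0, 0, 0, 0, 0, 0, 1, 0, 0, 0, -12;
    -15, 15, -15, 0, 0, -5, 0, 0, 0, 0, 0, 0, 0, 0, 0, 0, 1, 0, 0, -10;
    -12, 12, -12, 0, 0, -4, 0, 0, 0, 0, 0, 0, 0, 0, 0, 0, 0, 1, 0, -8;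
    -9, 9, -9, 0, 0, -3, 0, 0, 0, 0, 0, 0, 0, 0, 0, 0, 0, 0, 1, -6;
    -6, 6, -6, 0, 0, -2, 0, 0, 0, 0, 0, 0, 0, 0, 0, 0, 0, 0, 0, -3]

lemma T_mul_T : T * T = 1 := by decide +kernel

lemma T_transpose_mul_G_mul_T : Tᵀ * G * T = G := by decide +kernel

lemma T_mulVec_T_mulVec (x : Fin 20 → ℤ) : T *ᵥ (T *ᵥ x) = x := by
  rw [mulVec_mulVec, T_mul_T, one_mulVec]

lemma B_T_mulVec (x y : Fin 20 → ℤ) : B (T *ᵥ x) (T *ᵥ y) = B x y := by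
  rw [B, B, mulVec_mulVec, ← vecMul_transpose, ← dotProduct_mulVec, mulVec_mulVec,
    ← Matrix.mul_assoc, T_transpose_mul_G_mul_T]

/-- The involution given by `T`. -/
def reversal : (Fin 20 → ℤ) ≃ₗ[ℤ] (Fin 20 → ℤ) :=
  LinearEquiv.ofInvolutive T.mulVecLin T_mulVec_T_mulVec

lemma reversal_apply (x : Fin 20 → ℤ) : reversal x = T *ᵥ x := rfl

/-- The wall normals of the Vinberg fundamental polyhedron. -/
def walls : List (Fin 20 → ℤ) :=
  [e1, e2, e3, e4, e5, e6, e7, e8, e1', e2', e3', e4', e5', e6', e7', e8', v1, v2, v4, v5, v5', v6,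
    v7, v7']

lemma T_mulVec_mem_walls : ∀ x ∈ walls, T *ᵥ x ∈ walls := by decide +kernel

lemma setOf_mem_walls : {x | x ∈ walls} = {e1, e2, e3, e4, e5, e6, e7, e8, e1', e2', e3', e4', e5', e6', e7',
    e8', v1, v2, v4, v5, v5', v6, v7, v7'} := by
  ext x
  simp only [walls, List.mem_cons, List.not_mem_nil, or_false, Set.mem_ofPred_eq,
    Set.mem_insert_iff, Set.mem_singleton_iff]

lemma reversal_image_walls : ⇑reversal '' {x | x ∈ walls} = {x | x ∈ walls} := by
  refine subset_antisymm ?_ fun x hx => ⟨T *ᵥ x, T_mulVec_mem_walls x hx, T_mulVec_T_mulVec x⟩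
  rintro _ ⟨x, hx, rfl⟩
  exact T_mulVec_mem_walls x hx

/-- There is a `ℤ/3`-reversing involutive isometry of `U ⊕ A₂ ⊕ 2E₈`
preserving the 24-element set of wall normals of the Vinberg fundamental
polyhedron, fixing `e₇, e₇', e₄', v₆`, sending `v₁` to `e₄` and `v₃` to `v₈'`,
with `v₃ + v₈' ∈ 3L`. -/
theorem exists_reversing_involution :
    ∃ f : (Fin 20 → ℤ) ≃ₗ[ℤ] (Fin 20 → ℤ),
      (∀ x y, B (f x) (f y) = B x y) ∧
      (∀ x, f (f x) = x) ∧
      ⇑f '' ({e1, e2, e3, e4, e5, e6, e7, e8, e1', e2', e3', e4', e5', e6', e7', e8', v1, v2, v4, v5, v5', v6, v7, v7'} : Set (Fin 20 → ℤ)) = {e1, e2, e3, e4, e5, e6, e7, e8, e1', e2', e3', e4', e5', e6', e7', e8', v1, v2, v4, v5, v5', v6, v7, v7'} ∧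
      f e7 = e7 ∧ f e7' = e7' ∧ f e4' = e4' ∧ f v6 = v6 ∧
      f v1 = e4 ∧ f v3 = v8' ∧
      (∃ w : Fin 20 → ℤ, v3 + v8' = 3 • w) := by
  refine ⟨reversal, B_T_mulVec, T_mulVec_T_mulVec, ?_, ?_, ?_, ?_, ?_, ?_, ?_,
    ![2, -2, -1, -1, -4, -5, -7, -10, -8, -6, -4, -2, -2, -3, -4, -6, -5, -4, -3, -2], by decide +kernel⟩
  · rw [← setOf_mem_walls]
    exact reversal_image_walls
  all_goals
    rw [reversal_apply]
    decide +kernel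

end Stmt2
end

section
/- Let L = ⟨−2⟩ ⊕ A₂ and set v₁ = a₂, v₂ = a₁ − a₂, v₃ = 3b − 4a₁ − 2a₂. Then every isometry f of L with f({v₁, v₂, v₃}) = {v₁, v₂, v₃} is the identity. (These three vectors are the wall normals of the Vinberg fundamental polyhedron of ⟨−2⟩ ⊕ A₂; the absence of nontrivial symmetries underlies the chirality of the corresponding class of (M−1)-cubics.) -/
open Matrix

namespace Stmt3

/-- Gram matrix of the lattice. -/
def G : Matrix (Fin 3) (Fin 3) ℤ :=
  !![-2, 0, 0;
    0, 2, -1;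
    0, -1, 2]

/-- The bilinear form of the lattice. -/
def B (x y : Fin 3 → ℤ) : ℤ := x ⬝ᵥ G.mulVec y

def v1 : Fin 3 → ℤ := ![0, 0, 1]

def v2 : Fin 3 → ℤ := ![0, 1, -1]

def v3 : Fin 3 → ℤ := ![3, -4, -2]

theorem B_apply (x y : Fin 3 → ℤ) :
    B x y = -2 * x 0 * y 0 + x 1 * (2 * y 1 - y 2) + x 2 * (2 * y 2 - y 1) := by
  simp [B, G, Matrix.mulVec, dotProduct, Fin.sum_univ_three]
  ring

/-- A linear map fixing the three wall normals is the identity. -/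
theorem eq_self_of_fixes_walls (f : (Fin 3 → ℤ) ≃ₗ[ℤ] (Fin 3 → ℤ))
    (h1 : f v1 = v1) (h2 : f v2 = v2) (h3 : f v3 = v3) (x : Fin 3 → ℤ) : f x = x := by
  have hx : (3 : ℤ) • x =
      (x 0) • v3 + (4 * x 0 + 3 * x 1) • v2 + (6 * x 0 + 3 * x 1 + 3 * x 2) • v1 := by
    ext i
    fin_cases i <;> simp [v1, v2, v3] <;> ring
  have hf : (3 : ℤ) • f x = (3 : ℤ) • x := by
    rw [← map_smul, hx]
    simp only [map_add, map_smul, h1, h2, h3]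
  exact smul_right_injective _ (by norm_num : (3 : ℤ) ≠ 0) hf

/-- Every isometry of `⟨−2⟩ ⊕ A₂` preserving the set of wall normals
`{v₁, v₂, v₃}` of the Vinberg fundamental polyhedron is the identity. -/
theorem no_symmetry (f : (Fin 3 → ℤ) ≃ₗ[ℤ] (Fin 3 → ℤ))
    (hB : ∀ x y, B (f x) (f y) = B x y)
    (hS : ⇑f '' ({v1, v2, v3} : Set (Fin 3 → ℤ)) = {v1, v2, v3}) :
    ∀ x, f x = x := by
  have hmem : ∀ v ∈ ({v1, v2, v3} : Set (Fin 3 → ℤ)), f v = v1 ∨ f v = v2 ∨ f v = v3 := by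
    intro v hv
    have h : f v ∈ ({v1, v2, v3} : Set (Fin 3 → ℤ)) := hS ▸ Set.mem_image_of_mem f hv
    simpa using h
  have b11 : B v1 v1 = 2 := by simp [B_apply, v1]
  have b22 : B v2 v2 = 6 := by simp [B_apply, v2]
  have b33 : B v3 v3 = 6 := by simp [B_apply, v3]
  have b12 : B v1 v2 = -3 := by simp [B_apply, v1, v2]
  have b13 : B v1 v3 = 0 := by simp [B_apply, v1, v3]
  have h1 : f v1 = v1 := by
    have h := hB v1 v1
    rcases hmem v1 (by simp) with e | e | e
    · exact e
    · rw [e] at h; omega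
    · rw [e] at h; omega
  have h2 : f v2 = v2 := by
    have h := hB v1 v2
    rw [h1] at h
    rcases hmem v2 (by simp) with e | e | e
    · rw [e] at h; omega
    · exact e
    · rw [e] at h; omega
  have h3 : f v3 = v3 := by
    have h := hB v1 v3
    rw [h1] at h
    rcases hmem v3 (by simp) with e | e | e
    · rw [e] at h; omega
    · rw [e] at h; omega
    · exact e
  exact eq_self_of_fixes_walls f h1 h2 h3

end Stmt3
end

section
/- Let L = U ⊕ A₂ ⊕ A₁ and set v₁ = u₁ + u₂, v₂ = a₂, v₃ = a₁ − a₂, v₄ = c, v₅ = −u₂ − a₁ − a₂, v₆ = −u₂ − c. Then every isometry f of L with f({v₁, v₂, v₃, v₄, v₅, v₆}) = {v₁, v₂, v₃, v₄, v₅, v₆} is the identity. (These six vectors are the wall normals of the Vinberg fundamental polyhedron of U ⊕ A₂ ⊕ A₁; the absence of nontrivial symmetries underlies the chirality of the corresponding class of (M−1)-cubics.) -/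
open Matrix

namespace Stmt4

/-- Gram matrix of the lattice. -/
def G : Matrix (Fin 5) (Fin 5) ℤ :=
  !![0, 1, 0, 0, 0;
    1, 0, 0, 0, 0;
    0, 0, 2, -1, 0;
    0, 0, -1, 2, 0;
    0, 0, 0, 0, 2]

/-- The bilinear form of the lattice. -/
def B (x y : Fin 5 → ℤ) : ℤ := x ⬝ᵥ G.mulVec y

def v1 : Fin 5 → ℤ := ![1, 1, 0, 0, 0]

def v2 : Fin 5 → ℤ := ![0, 0, 0, 1, 0]

def v3 : Fin 5 → ℤ := ![0, 0, 1, -1, 0]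

def v4 : Fin 5 → ℤ := ![0, 0, 0, 0, 1]

def v5 : Fin 5 → ℤ := ![0, -1, -1, -1, 0]

def v6 : Fin 5 → ℤ := ![0, -1, 0, 0, -1]

/-- The wall normals span the lattice. -/
lemma eq_combination_wall_normals (x : Fin 5 → ℤ) :
    x = x 0 • v1 + (x 0 - x 1) • v5 + (x 2 - x 1 + x 0) • v3 +
      (x 2 + x 3 - 2 * x 1 + 2 * x 0) • v2 + x 4 • v4 := by
  ext i
  fin_cases i <;> simp [v1, v2, v3, v4, v5]
  ring

/-- Every isometry of `U ⊕ A₂ ⊕ A₁` preserving the set of wall normals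
`{v₁, …, v₆}` of the Vinberg fundamental polyhedron is the identity. -/
theorem no_symmetry (f : (Fin 5 → ℤ) ≃ₗ[ℤ] (Fin 5 → ℤ))
    (hB : ∀ x y, B (f x) (f y) = B x y)
    (hS : ⇑f '' ({v1, v2, v3, v4, v5, v6} : Set (Fin 5 → ℤ)) =
      {v1, v2, v3, v4, v5, v6}) :
    ∀ x, f x = x := by
  have hmem : ∀ v ∈ ({v1, v2, v3, v4, v5, v6} : Set (Fin 5 → ℤ)),
      f v = v1 ∨ f v = v2 ∨ f v = v3 ∨ f v = v4 ∨ f v = v5 ∨ f v = v6 := by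
    intro v hv
    simpa only [Set.mem_insert_iff, Set.mem_singleton_iff] using
      hS.subset (Set.mem_image_of_mem f hv)
  have h3 : f v3 = v3 := by
    have h := hB v3 v3
    rcases hmem v3 (by simp) with e | e | e | e | e | e <;> rw [e] at h ⊢ <;> revert h <;> decide
  have h2 : f v2 = v2 := by
    have h := hB v3 v2
    rw [h3] at h
    rcases hmem v2 (by simp) with e | e | e | e | e | e <;> rw [e] at h ⊢ <;> revert h <;> decide
  have h5 : f v5 = v5 := by
    have h := hB v2 v5
    rw [h2] at h
    rcases hmem v5 (by simp) with e | e | e | e | e | e <;> rw [e] at h ⊢ <;> revert h <;> decide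
  have h1 : f v1 = v1 := by
    have h := And.intro (hB v5 v1) (hB v2 v1)
    rw [h5, h2] at h
    rcases hmem v1 (by simp) with e | e | e | e | e | e <;> rw [e] at h ⊢ <;> revert h <;> decide
  have h6 : f v6 = v6 := by
    have h := And.intro (hB v1 v6) (hB v5 v6)
    rw [h1, h5] at h
    rcases hmem v6 (by simp) with e | e | e | e | e | e <;> rw [e] at h ⊢ <;> revert h <;> decide
  have h4 : f v4 = v4 := by
    have h := hB v6 v4
    rw [h6] at h
    rcases hmem v4 (by simp) with e | e | e | e | e | e <;> rw [e] at h ⊢ <;> revert h <;> decide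
  intro x
  rw [eq_combination_wall_normals x]
  simp only [map_add, map_smul, h1, h2, h3, h4, h5]

end Stmt4
end

section
/- Let L = ⟨−2⟩ ⊕ A₂ ⊕ E₈ and set v₁ = a₂, v₂ = a₁ − a₂, v₃ = b − e₁*, v₄ = b − a₁ − a₂ − e₈*, v₅ = 3b − 4a₁ − 2a₂. Then every isometry f of L with f(S) = S, where S = {e₁, …, e₈, v₁, v₂, v₃, v₄, v₅}, is the identity. (These thirteen vectors are the wall normals of the Vinberg fundamental polyhedron of ⟨−2⟩ ⊕ A₂ ⊕ E₈; the absence of nontrivial symmetries underlies the chirality of the corresponding class of (M−1)-cubics.) -/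
open Matrix

namespace Stmt5

/-- Gram matrix of the lattice. -/
def G : Matrix (Fin 11) (Fin 11) ℤ :=
  !![-2, 0, 0, 0, 0, 0, 0, 0, 0, 0, 0;
    0, 2, -1, 0, 0, 0, 0, 0, 0, 0, 0;
    0, -1, 2, 0, 0, 0, 0, 0, 0, 0, 0;
    0, 0, 0, 2, 0, -1, 0, 0, 0, 0, 0;
    0, 0, 0, 0, 2, 0, -1, 0, 0, 0, 0;
    0, 0, 0, -1, 0, 2, -1, 0, 0, 0, 0;
    0, 0, 0, 0, -1, -1, 2, -1, 0, 0, 0;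
    0, 0, 0, 0, 0, 0, -1, 2, -1, 0, 0;
    0, 0, 0, 0, 0, 0, 0, -1, 2, -1, 0;
    0, 0, 0, 0, 0, 0, 0, 0, -1, 2, -1;
    0, 0, 0, 0, 0, 0, 0, 0, 0, -1, 2]

/-- The bilinear form of the lattice. -/
def B (x y : Fin 11 → ℤ) : ℤ := x ⬝ᵥ G.mulVec y

def e1 : Fin 11 → ℤ := ![0, 0, 0, 1, 0, 0, 0, 0, 0, 0, 0]

def e2 : Fin 11 → ℤ := ![0, 0, 0, 0, 1, 0, 0, 0, 0, 0, 0]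

def e3 : Fin 11 → ℤ := ![0, 0, 0, 0, 0, 1, 0, 0, 0, 0, 0]

def e4 : Fin 11 → ℤ := ![0, 0, 0, 0, 0, 0, 1, 0, 0, 0, 0]

def e5 : Fin 11 → ℤ := ![0, 0, 0, 0, 0, 0, 0, 1, 0, 0, 0]

def e6 : Fin 11 → ℤ := ![0, 0, 0, 0, 0, 0, 0, 0, 1, 0, 0]

def e7 : Fin 11 → ℤ := ![0, 0, 0, 0, 0, 0, 0, 0, 0, 1, 0]

def e8 : Fin 11 → ℤ := ![0, 0, 0, 0, 0, 0, 0, 0, 0, 0, 1]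

def v1 : Fin 11 → ℤ := ![0, 0, 1, 0, 0, 0, 0, 0, 0, 0, 0]

def v2 : Fin 11 → ℤ := ![0, 1, -1, 0, 0, 0, 0, 0, 0, 0, 0]

def v3 : Fin 11 → ℤ := ![1, 0, 0, -4, -5, -7, -10, -8, -6, -4, -2]

def v4 : Fin 11 → ℤ := ![1, -1, -1, -2, -3, -4, -6, -5, -4, -3, -2]

def v5 : Fin 11 → ℤ := ![3, -4, -2, 0, 0, 0, 0, 0, 0, 0, 0]

/-- The thirteen wall normals, indexed in the order in which they are listed. -/
def wall : Fin 13 → Fin 11 → ℤ :=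
  ![e1, e2, e3, e4, e5, e6, e7, e8, v1, v2, v3, v4, v5]

/-- The Gram matrix of the thirteen wall normals. -/
def wallGram (i j : Fin 13) : ℤ := B (wall i) (wall j)

theorem range_wall :
    Set.range wall = {e1, e2, e3, e4, e5, e6, e7, e8, v1, v2, v3, v4, v5} := by
  simp only [wall, Matrix.range_cons, Matrix.range_empty, Set.union_empty, Set.singleton_union]

/-- The wall diagram has no nontrivial symmetries: any self-map of the index set preserving
the Gram matrix is the identity. -/
theorem eq_id_of_wallGram_eq (s : Fin 13 → Fin 13)
    (h : ∀ i j, wallGram (s i) (s j) = wallGram i j) (i : Fin 13) : s i = i := by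
  have g : ∀ a b k l, s a = k → wallGram a b = l → wallGram k (s b) = l := by
    rintro a b k l rfl rfl
    exact h a b
  have n : ∀ a, wallGram (s a) (s a) = wallGram a a := fun a => h a a
  have h98 : s 9 = 9 ∧ s 8 = 8 :=
    (by decide +kernel : ∀ a b, wallGram a b = wallGram 9 8 → wallGram a a = wallGram 9 9 →
      a = 9 ∧ b = 8) _ _ (h 9 8) (n 9)
  obtain ⟨h9, h8⟩ := h98
  have h12 : s 12 = 12 :=
    (by decide +kernel : ∀ c, wallGram 9 c = wallGram 9 12 → wallGram c c = wallGram 12 12 → c = 12)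
      _ (g 9 12 9 _ h9 rfl) (n 12)
  have h10 : s 10 = 10 :=
    (by decide +kernel : ∀ c, wallGram 12 c = wallGram 12 10 → wallGram c c = wallGram 10 10 → c = 10)
      _ (g 12 10 12 _ h12 rfl) (n 10)
  have h0 : s 0 = 0 :=
    (by decide +kernel : ∀ c, wallGram 10 c = wallGram 10 0 → wallGram c c = wallGram 0 0 → c = 0)
      _ (g 10 0 10 _ h10 rfl) (n 0)
  have h11 : s 11 = 11 :=
    (by decide +kernel : ∀ c, wallGram 8 c = wallGram 8 11 → wallGram c c = wallGram 11 11 → c = 11)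
      _ (g 8 11 8 _ h8 rfl) (n 11)
  have h7 : s 7 = 7 :=
    (by decide +kernel : ∀ c, wallGram 11 c = wallGram 11 7 → wallGram 9 c = wallGram 9 7 → c = 7)
      _ (g 11 7 11 _ h11 rfl) (g 9 7 9 _ h9 rfl)
  have h6 : s 6 = 6 :=
    (by decide +kernel : ∀ c, wallGram 7 c = wallGram 7 6 → wallGram 8 c = wallGram 8 6 → c = 6)
      _ (g 7 6 7 _ h7 rfl) (g 8 6 8 _ h8 rfl)
  have h5 : s 5 = 5 :=
    (by decide +kernel : ∀ c, wallGram 6 c = wallGram 6 5 → wallGram 11 c = wallGram 11 5 → c = 5)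
      _ (g 6 5 6 _ h6 rfl) (g 11 5 11 _ h11 rfl)
  have h4 : s 4 = 4 :=
    (by decide +kernel : ∀ c, wallGram 5 c = wallGram 5 4 → wallGram 7 c = wallGram 7 4 → c = 4)
      _ (g 5 4 5 _ h5 rfl) (g 7 4 7 _ h7 rfl)
  have h3 : s 3 = 3 :=
    (by decide +kernel : ∀ c, wallGram 4 c = wallGram 4 3 → wallGram 6 c = wallGram 6 3 → c = 3)
      _ (g 4 3 4 _ h4 rfl) (g 6 3 6 _ h6 rfl)
  have h2 : s 2 = 2 :=
    (by decide +kernel : ∀ c, wallGram 0 c = wallGram 0 2 → wallGram 12 c = wallGram 12 2 → c = 2)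
      _ (g 0 2 0 _ h0 rfl) (g 12 2 12 _ h12 rfl)
  have h1 : s 1 = 1 :=
    (by decide +kernel : ∀ c, wallGram 3 c = wallGram 3 1 → wallGram 0 c = wallGram 0 1 →
      wallGram 5 c = wallGram 5 1 → c = 1)
      _ (g 3 1 3 _ h3 rfl) (g 0 1 0 _ h0 rfl) (g 5 1 5 _ h5 rfl)
  fin_cases i <;> assumption

/-- The wall normals span the lattice. -/
theorem eq_wall_combination (x : Fin 11 → ℤ) :
    x = x 0 • v3 + x 1 • v2 + (x 1 + x 2) • v1 + (x 3 + 4 * x 0) • e1 + (x 4 + 5 * x 0) • e2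
      + (x 5 + 7 * x 0) • e3 + (x 6 + 10 * x 0) • e4 + (x 7 + 8 * x 0) • e5
      + (x 8 + 6 * x 0) • e6 + (x 9 + 4 * x 0) • e7 + (x 10 + 2 * x 0) • e8 := by
  ext i
  fin_cases i <;> simp [v1, v2, v3, e1, e2, e3, e4, e5, e6, e7, e8] <;> ring

/-- Every isometry of `⟨−2⟩ ⊕ A₂ ⊕ E₈` preserving the set of the thirteen
wall normals of the Vinberg fundamental polyhedron is the identity. -/
theorem no_symmetry (f : (Fin 11 → ℤ) ≃ₗ[ℤ] (Fin 11 → ℤ))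
    (hB : ∀ x y, B (f x) (f y) = B x y)
    (hS : ⇑f '' ({e1, e2, e3, e4, e5, e6, e7, e8,
      v1, v2, v3, v4, v5} : Set (Fin 11 → ℤ)) =
      {e1, e2, e3, e4, e5, e6, e7, e8, v1, v2, v3, v4, v5}) :
    ∀ x, f x = x := by
  rw [← range_wall] at hS
  have hmem : ∀ i, ∃ j, f (wall i) = wall j := fun i => by
    obtain ⟨j, hj⟩ : f (wall i) ∈ Set.range wall := hS ▸ Set.mem_image_of_mem f ⟨i, rfl⟩
    exact ⟨j, hj.symm⟩
  choose s hs using hmem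
  have hid := eq_id_of_wallGram_eq s fun i j => by
    simp only [wallGram, ← hs, hB]
  have hfix : ∀ i, f (wall i) = wall i := fun i => by rw [hs, hid]
  intro x
  rw [eq_wall_combination x]
  simp only [map_add, map_smul]
  rw [show f v3 = v3 from hfix 10, show f v2 = v2 from hfix 9, show f v1 = v1 from hfix 8,
    show f e1 = e1 from hfix 0, show f e2 = e2 from hfix 1, show f e3 = e3 from hfix 2,
    show f e4 = e4 from hfix 3, show f e5 = e5 from hfix 4, show f e6 = e6 from hfix 5,
    show f e7 = e7 from hfix 6, show f e8 = e8 from hfix 7]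

end Stmt5
end

section
/- Let L = U ⊕ A₂ ⊕ E₈ ⊕ E₈ and let S be the 24-element set consisting of e₁, …, e₈, e₁', …, e₈', v₁ = u₁+u₂, v₂ = a₂, v₄ = −(u₂+a₁+a₂), v₅ = −u₂−e₈*, v₅' = −u₂−(e₈')*, v₆ = 2(u₁−u₂)−a₁−a₂−e₁*−(e₁')*, v₇ = 3(u₁−u₂)−2a₁−a₂−e₇*−(e₂')*, and v₇' = 3(u₁−u₂)−2a₁−a₂−e₂*−(e₇')*. Set v₃ = a₁−a₂. Then there exists an isometry g of L with g ∘ g = id such that g(S) = S, g(v₁) = v₁, and v₃ + g(v₃) ∈ 3L. (Such a ℤ/3-reversing involution fixing v₁ and preserving the Vinberg fundamental polyhedron is the key step in proving achirality of the lattice −A₁ + A₂ + 2E₈, the orthogonal complement of v₁.) -/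
open Matrix

namespace Stmt7

/-- Gram matrix of the lattice. -/
def G : Matrix (Fin 20) (Fin 20) ℤ :=
  !![0, 1, 0, 0, 0, 0, 0, 0, 0, 0, 0, 0, 0, 0, 0, 0, 0, 0, 0, 0;
    1, 0, 0, 0, 0, 0, 0, 0, 0, 0, 0, 0, 0, 0, 0, 0, 0, 0, 0, 0;
    0, 0, 2, -1, 0, 0, 0, 0, 0, 0, 0, 0, 0, 0, 0, 0, 0, 0, 0, 0;
    0, 0, -1, 2, 0, 0, 0, 0, 0, 0, 0, 0, 0, 0, 0, 0, 0, 0, 0, 0;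
    0, 0, 0, 0, 2, 0, -1, 0, 0, 0, 0, 0, 0, 0, 0, 0, 0, 0, 0, 0;
    0, 0, 0, 0, 0, 2, 0, -1, 0, 0, 0, 0, 0, 0, 0, 0, 0, 0, 0, 0;
    0, 0, 0, 0, -1, 0, 2, -1, 0, 0, 0, 0, 0, 0, 0, 0, 0, 0, 0, 0;
    0, 0, 0, 0, 0, -1, -1, 2, -1, 0, 0, 0, 0, 0, 0, 0, 0, 0, 0, 0;
    0, 0, 0, 0, 0, 0, 0, -1, 2, -1, 0, 0, 0, 0, 0, 0, 0, 0, 0, 0;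
    0, 0, 0, 0, 0, 0, 0, 0, -1, 2, -1, 0, 0, 0, 0, 0, 0, 0, 0, 0;
    0, 0, 0, 0, 0, 0, 0, 0, 0, -1, 2, -1, 0, 0, 0, 0, 0, 0, 0, 0;
    0, 0, 0, 0, 0, 0, 0, 0, 0, 0, -1, 2, 0, 0, 0, 0, 0, 0, 0, 0;
    0, 0, 0, 0, 0, 0, 0, 0, 0, 0, 0, 0, 2, 0, -1, 0, 0, 0, 0, 0;
    0, 0, 0, 0, 0, 0, 0, 0, 0, 0, 0, 0, 0, 2, 0, -1, 0, 0, 0, 0;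
    0, 0, 0, 0, 0, 0, 0, 0, 0, 0, 0, 0, -1, 0, 2, -1, 0, 0, 0, 0;
    0, 0, 0, 0, 0, 0, 0, 0, 0, 0, 0, 0, 0, -1, -1, 2, -1, 0, 0, 0;
    0, 0, 0, 0, 0, 0, 0, 0, 0, 0, 0, 0, 0, 0, 0, -1, 2, -1, 0, 0;
    0, 0, 0, 0, 0, 0, 0, 0, 0, 0, 0, 0, 0, 0, 0, 0, -1, 2, -1, 0;
    0, 0, 0, 0, 0, 0, 0, 0, 0, 0, 0, 0, 0, 0, 0, 0, 0, -1, 2, -1;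
    0, 0, 0, 0, 0, 0, 0, 0, 0, 0, 0, 0, 0, 0, 0, 0, 0, 0, -1, 2]

/-- The bilinear form of the lattice. -/
def B (x y : Fin 20 → ℤ) : ℤ := x ⬝ᵥ G.mulVec y

def e1 : Fin 20 → ℤ := ![0, 0, 0, 0, 1, 0, 0, 0, 0, 0, 0, 0, 0, 0, 0, 0, 0, 0, 0, 0]

def e1' : Fin 20 → ℤ := ![0, 0, 0, 0, 0, 0, 0, 0, 0, 0, 0, 0, 1, 0, 0, 0, 0, 0, 0, 0]

def e2 : Fin 20 → ℤ := ![0, 0, 0, 0, 0, 1, 0, 0, 0, 0, 0, 0, 0, 0, 0, 0, 0, 0, 0, 0]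

def e2' : Fin 20 → ℤ := ![0, 0, 0, 0, 0, 0, 0, 0, 0, 0, 0, 0, 0, 1, 0, 0, 0, 0, 0, 0]

def e3 : Fin 20 → ℤ := ![0, 0, 0, 0, 0, 0, 1, 0, 0, 0, 0, 0, 0, 0, 0, 0, 0, 0, 0, 0]

def e3' : Fin 20 → ℤ := ![0, 0, 0, 0, 0, 0, 0, 0, 0, 0, 0, 0, 0, 0, 1, 0, 0, 0, 0, 0]

def e4 : Fin 20 → ℤ := ![0, 0, 0, 0, 0, 0, 0, 1, 0, 0, 0, 0, 0, 0, 0, 0, 0, 0, 0, 0]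

def e4' : Fin 20 → ℤ := ![0, 0, 0, 0, 0, 0, 0, 0, 0, 0, 0, 0, 0, 0, 0, 1, 0, 0, 0, 0]

def e5 : Fin 20 → ℤ := ![0, 0, 0, 0, 0, 0, 0, 0, 1, 0, 0, 0, 0, 0, 0, 0, 0, 0, 0, 0]

def e5' : Fin 20 → ℤ := ![0, 0, 0, 0, 0, 0, 0, 0, 0, 0, 0, 0, 0, 0, 0, 0, 1, 0, 0, 0]

def e6 : Fin 20 → ℤ := ![0, 0, 0, 0, 0, 0, 0, 0, 0, 1, 0, 0, 0, 0, 0, 0, 0, 0, 0, 0]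

def e6' : Fin 20 → ℤ := ![0, 0, 0, 0, 0, 0, 0, 0, 0, 0, 0, 0, 0, 0, 0, 0, 0, 1, 0, 0]

def e7 : Fin 20 → ℤ := ![0, 0, 0, 0, 0, 0, 0, 0, 0, 0, 1, 0, 0, 0, 0, 0, 0, 0, 0, 0]

def e7' : Fin 20 → ℤ := ![0, 0, 0, 0, 0, 0, 0, 0, 0, 0, 0, 0, 0, 0, 0, 0, 0, 0, 1, 0]

def e8 : Fin 20 → ℤ := ![0, 0, 0, 0, 0, 0, 0, 0, 0, 0, 0, 1, 0, 0, 0, 0, 0, 0, 0, 0]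

def e8' : Fin 20 → ℤ := ![0, 0, 0, 0, 0, 0, 0, 0, 0, 0, 0, 0, 0, 0, 0, 0, 0, 0, 0, 1]

def v1 : Fin 20 → ℤ := ![1, 1, 0, 0, 0, 0, 0, 0, 0, 0, 0, 0, 0, 0, 0, 0, 0, 0, 0, 0]

def v2 : Fin 20 → ℤ := ![0, 0, 0, 1, 0, 0, 0, 0, 0, 0, 0, 0, 0, 0, 0, 0, 0, 0, 0, 0]

def v3 : Fin 20 → ℤ := ![0, 0, 1, -1, 0, 0, 0, 0, 0, 0, 0, 0, 0, 0, 0, 0, 0, 0, 0, 0]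

def v4 : Fin 20 → ℤ := ![0, -1, -1, -1, 0, 0, 0, 0, 0, 0, 0, 0, 0, 0, 0, 0, 0, 0, 0, 0]

def v5 : Fin 20 → ℤ := ![0, -1, 0, 0, -2, -3, -4, -6, -5, -4, -3, -2, 0, 0, 0, 0, 0, 0, 0, 0]

def v5' : Fin 20 → ℤ := ![0, -1, 0, 0, 0, 0, 0, 0, 0, 0, 0, 0, -2, -3, -4, -6, -5, -4, -3, -2]

def v6 : Fin 20 → ℤ := ![2, -2, -1, -1, -4, -5, -7, -10, -8, -6, -4, -2, -4, -5, -7, -10, -8, -6, -4, -2]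

def v7 : Fin 20 → ℤ := ![3, -3, -2, -1, -4, -6, -8, -12, -10, -8, -6, -3, -5, -8, -10, -15, -12, -9, -6, -3]

def v7' : Fin 20 → ℤ := ![3, -3, -2, -1, -5, -8, -10, -15, -12, -9, -6, -3, -4, -6, -8, -12, -10, -8, -6, -3]

/-- The matrix of an involutive isometry of the lattice which permutes the wall normals. -/
def reversingMatrix : Matrix (Fin 20) (Fin 20) ℤ :=
  !![7, -6, 6, 0, 3, 0, 0, 0, 0, 0, 0, 0, 0, 0, 0, 0, 0, 0, 2, 0;
    -6, 7, -6, 0, -3, 0, 0, 0, 0, 0, 0, 0, 0, 0, 0, 0, 0, 0, -2, 0;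
    -4, 4, -4, 0, -2, 0, 0, 0, 0, 0, 0, 0, 0, 0, 0, 0, 0, 0, -1, 0;
    -2, 2, -2, 0, -1, 0, 0, 0, 0, 0, 0, 0, 0, 0, 0, 0, 0, 0, -1, 1;
    -12, 12, -12, 0, -5, 0, 0, 0, 0, 0, 0, 0, 0, 0, 0, 0, 0, 0, -4, 0;
    -15, 15, -15, 0, -8, 0, 1, 0, 0, 0, 0, 0, 0, 0, 0, 0, 0, 0, -5, 0;
    -21, 21, -21, 0, -10, 1, 0, 0, 0, 0, 0, 0, 0, 0, 0, 0, 0, 0, -7, 0;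
    -30, 30, -30, 0, -15, 0, 0, 1, 0, 0, 0, 0, 0, 0, 0, 0, 0, 0, -10, 0;
    -24, 24, -24, 0, -12, 0, 0, 0, 1, 0, 0, 0, 0, 0, 0, 0, 0, 0, -8, 0;
    -18, 18, -18, 0, -9, 0, 0, 0, 0, 1, 0, 0, 0, 0, 0, 0, 0, 0, -6, 0;
    -12, 12, -12, 0, -6, 0, 0, 0, 0, 0, 1, 0, 0, 0, 0, 0, 0, 0, -4, 0;
    -6, 6, -6, 0, -3, 0, 0, 0, 0, 0, 0, 1, 0, 0, 0, 0, 0, 0, -2, 0;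
    -8, 8, -6, 0, -4, 0, 0, 0, 0, 0, 0, 0, 0, 0, 0, 0, 0, 1, -4, 0;
    -12, 12, -9, 0, -6, 0, 0, 0, 0, 0, 0, 0, 0, 1, 0, 0, 0, 0, -5, 0;
    -16, 16, -12, 0, -8, 0, 0, 0, 0, 0, 0, 0, 0, 0, 0, 0, 1, 0, -7, 0;
    -24, 24, -18, 0, -12, 0, 0, 0, 0, 0, 0, 0, 0, 0, 0, 1, 0, 0, -10, 0;
    -20, 20, -15, 0, -10, 0, 0, 0, 0, 0, 0, 0, 0, 0, 1, 0, 0, 0, -8, 0;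
    -16, 16, -12, 0, -8, 0, 0, 0, 0, 0, 0, 0, 1, 0, 0, 0, 0, 0, -6, 0;
    -12, 12, -9, 0, -6, 0, 0, 0, 0, 0, 0, 0, 0, 0, 0, 0, 0, 0, -4, 0;
    -6, 6, -5, 1, -3, 0, 0, 0, 0, 0, 0, 0, 0, 0, 0, 0, 0, 0, -2, 0]

theorem reversingMatrix_mul_self : reversingMatrix * reversingMatrix = 1 := by
  decide +kernel

theorem transpose_reversingMatrix_mul_G : reversingMatrixᵀ * G = G * reversingMatrix := by
  decide +kernel

theorem reversingMatrix_mulVec_mulVec (x : Fin 20 → ℤ) :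
    reversingMatrix *ᵥ (reversingMatrix *ᵥ x) = x := by
  rw [mulVec_mulVec, reversingMatrix_mul_self, one_mulVec]

theorem B_reversingMatrix_mulVec (x y : Fin 20 → ℤ) :
    B (reversingMatrix *ᵥ x) (reversingMatrix *ᵥ y) = B x y := by
  unfold B
  rw [← vecMul_transpose, ← dotProduct_mulVec, mulVec_mulVec, mulVec_mulVec,
    transpose_reversingMatrix_mul_G, mul_assoc, reversingMatrix_mul_self, mul_one]

/-- The involutive isometry given by `reversingMatrix`. -/
def reversingInvolution : (Fin 20 → ℤ) ≃ₗ[ℤ] (Fin 20 → ℤ) :=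
  LinearEquiv.ofInvolutive (mulVecLin reversingMatrix) reversingMatrix_mulVec_mulVec

theorem reversingInvolution_apply (x : Fin 20 → ℤ) :
    reversingInvolution x = reversingMatrix *ᵥ x := rfl

/-- The set of wall normals of the fundamental polyhedron. -/
abbrev wallNormals : Finset (Fin 20 → ℤ) :=
  {e1, e2, e3, e4, e5, e6, e7, e8, e1', e2', e3', e4', e5', e6', e7', e8',
    v1, v2, v4, v5, v5', v6, v7, v7'}

theorem reversingInvolution_mem_wallNormals :
    ∀ x ∈ wallNormals, reversingInvolution x ∈ wallNormals := by
  decide +kernel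

theorem image_reversingInvolution_wallNormals :
    wallNormals.image reversingInvolution = wallNormals :=
  Finset.eq_of_subset_of_card_le
    (Finset.image_subset_iff.mpr reversingInvolution_mem_wallNormals)
    (Finset.card_image_of_injective _ reversingInvolution.injective).ge

/-- There is a `ℤ/3`-reversing involutive isometry of `U ⊕ A₂ ⊕ 2E₈`
preserving the 24-element set of wall normals of the Vinberg fundamental
polyhedron and fixing `v₁`, with `v₃ + g(v₃) ∈ 3L`. -/
theorem exists_reversing_involution_fixing_v1 :
    ∃ g : (Fin 20 → ℤ) ≃ₗ[ℤ] (Fin 20 → ℤ),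
      (∀ x y, B (g x) (g y) = B x y) ∧
      (∀ x, g (g x) = x) ∧
      ⇑g '' ({e1, e2, e3, e4, e5, e6, e7, e8, e1', e2', e3', e4', e5', e6', e7', e8', v1, v2, v4, v5, v5', v6, v7, v7'} : Set (Fin 20 → ℤ)) = {e1, e2, e3, e4, e5, e6, e7, e8, e1', e2', e3', e4', e5', e6', e7', e8', v1, v2, v4, v5, v5', v6, v7, v7'} ∧
      g v1 = v1 ∧
      (∃ w : Fin 20 → ℤ, v3 + g v3 = 3 • w) := by
  refine ⟨reversingInvolution, B_reversingMatrix_mulVec, reversingMatrix_mulVec_mulVec, ?_, ?_,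
    ![2, -2, -1, -1, -4, -5, -7, -10, -8, -6, -4, -2, -2, -3, -4, -6, -5, -4, -3, -2], ?_⟩
  · simpa only [wallNormals, Finset.coe_image, Finset.coe_insert, Finset.coe_singleton] using
      congrArg (fun s : Finset (Fin 20 → ℤ) => (s : Set (Fin 20 → ℤ)))
        image_reversingInvolution_wallNormals
  · rw [reversingInvolution_apply]
    decide +kernel
  · rw [reversingInvolution_apply]
    decide +kernel

end Stmt7
end

section
/- Let N be a lattice, h ∈ N a vector with h·h = 3, and N₀ = {x ∈ N : x·h = 0} (on which the bilinear form is nondegenerate). Assume that the subgroup N₀ + ℤh has index 3 in N, and that the 3-torsion subgroup of the discriminant group N₀*/N₀ is cyclic of order 3, where N₀* = {x ∈ N₀ ⊗ ℚ : x·y ∈ ℤ for all y ∈ N₀}. Then every isometry f₀ of N₀ extends to an isometry f of N, this extension is unique, and it satisfies f(h) = h or f(h) = −h. -/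
/-- Two nontrivial elements of a cyclic group of order three agree up to sign. -/
theorem exists_sign_sub_mem {V : Type*} [AddCommGroup V] {N₀ : Submodule ℤ V}
    {g e e' : V} (he : e ∉ N₀) (he' : e' ∉ N₀)
    (h1 : e ∈ N₀ ∨ e - g ∈ N₀ ∨ e + g ∈ N₀) (h2 : e' ∈ N₀ ∨ e' - g ∈ N₀ ∨ e' + g ∈ N₀) :
    ∃ ε : ℤ, ε * ε = 1 ∧ e' - ε • e ∈ N₀ := by
  rcases h1.resolve_left he with h1 | h1 <;> rcases h2.resolve_left he' with h2 | h2
  · exact ⟨1, rfl, by simpa using N₀.sub_mem h2 h1⟩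
  · exact ⟨-1, rfl, by convert N₀.add_mem h2 h1 using 1; module⟩
  · exact ⟨-1, rfl, by convert N₀.add_mem h2 h1 using 1; module⟩
  · exact ⟨1, rfl, by convert N₀.sub_mem h2 h1 using 1; module⟩

section HyperplaneSection

variable {V : Type*} [AddCommGroup V] [Module ℚ V] {B : V →ₗ[ℚ] V →ₗ[ℚ] ℚ}
  {N N₀ : Submodule ℤ V} {h : V}

/-- The functional `x ↦ x · h` on `N` together with the projection `x ↦ 3x - (x · h) h` to `h^⊥`. -/
theorem exists_pairing_and_projection
    (hNint : ∀ x ∈ N, ∀ y ∈ N, ∃ n : ℤ, B x y = (n : ℚ))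
    (hhN : h ∈ N) (hh3 : B h h = 3) (hN₀ : ∀ x : V, x ∈ N₀ ↔ x ∈ N ∧ B x h = 0) :
    ∃ (κ : N →ₗ[ℤ] ℤ) (p : N →ₗ[ℤ] N₀), (∀ x : N, B (x : V) h = κ x) ∧
      ∀ x : N, (p x : V) = (3 : ℚ) • (x : V) - (κ x : ℚ) • h := by
  choose k hk using fun x : N => hNint x x.2 h hhN
  let κ : N →ₗ[ℤ] ℤ := AddMonoidHom.toIntLinearMap <| AddMonoidHom.mk' k fun x y => by
    have := hk (x + y)
    rw [Submodule.coe_add, map_add, LinearMap.add_apply, hk x, hk y] at this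
    exact_mod_cast this.symm
  have hmem (x : N) : (3 : ℚ) • (x : V) - (k x : ℚ) • h ∈ N₀ := by
    refine (hN₀ _).2 ⟨?_, ?_⟩
    · have h1 := N.sub_mem (N.smul_mem (3 : ℤ) x.2) (N.smul_mem (k x) hhN)
      simpa only [← Int.cast_smul_eq_zsmul ℚ, Int.cast_ofNat] using h1
    · simp only [map_sub, map_smul, LinearMap.sub_apply, LinearMap.smul_apply, hk x, hh3,
        smul_eq_mul]
      ring
  refine ⟨κ, AddMonoidHom.toIntLinearMap <| AddMonoidHom.mk' (fun x => ⟨_, hmem x⟩) fun x y => ?_,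
    hk, fun x => rfl⟩
  have hκ : k (x + y) = k x + k y := map_add κ x y
  ext
  simp only [hκ, Submodule.coe_add]
  push_cast
  module

theorem eq_zero_of_orthogonal_hyperplane
    (hnd : ∀ x : V, (∀ y : V, B x y = 0) → x = 0)
    (hNspan : Submodule.span ℚ (N : Set V) = ⊤)
    {κ : N →ₗ[ℤ] ℤ} {p : N →ₗ[ℤ] N₀}
    (hp : ∀ x : N, (p x : V) = (3 : ℚ) • (x : V) - (κ x : ℚ) • h)
    {v : V} (hv : ∀ y ∈ N₀, B v y = 0) (hvh : B v h = 0) : v = 0 := by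
  refine hnd v fun y => ?_
  have hy : y ∈ Submodule.span ℚ (N : Set V) := hNspan ▸ Submodule.mem_top
  induction hy using Submodule.span_induction with
  | mem y hy =>
    have := hv _ (p ⟨y, hy⟩).2
    rw [hp, map_sub, map_smul, map_smul, hvh] at this
    simpa using this
  | zero => simp
  | add x y _ _ hx hy => rw [map_add, hx, hy, add_zero]
  | smul a x _ hx => rw [map_smul, hx, smul_zero]

theorem exists_pairing_eq_one
    (hhN : h ∈ N) (hh3 : B h h = 3) (hN₀ : ∀ x : V, x ∈ N₀ ↔ x ∈ N ∧ B x h = 0)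
    (hindex : Nat.card
      (N ⧸ (Submodule.comap N.subtype (N₀ ⊔ Submodule.span ℤ {h}))) = 3)
    {κ : N →ₗ[ℤ] ℤ} (hκ : ∀ x : N, B (x : V) h = κ x) :
    ∃ u : N, κ u = 1 := by
  have hκh : κ ⟨h, hhN⟩ = 3 := by
    have := hκ ⟨h, hhN⟩
    rw [hh3] at this
    exact_mod_cast this.symm
  obtain ⟨x, hx⟩ : ∃ x : N, ¬ (3 : ℤ) ∣ κ x := by
    by_contra! hall
    have htop : Submodule.comap N.subtype (N₀ ⊔ Submodule.span ℤ {h}) = ⊤ := by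
      refine eq_top_iff.2 fun x _ => ?_
      obtain ⟨m, hm⟩ := hall x
      rw [Submodule.mem_comap, Submodule.mem_sup]
      refine ⟨x - m • h, (hN₀ _).2 ⟨N.sub_mem x.2 (N.smul_mem m hhN), ?_⟩, m • h,
        Submodule.smul_mem _ _ (Submodule.mem_span_singleton_self h), by simp⟩
      rw [map_sub, LinearMap.sub_apply, hκ, hm, ← Int.cast_smul_eq_zsmul ℚ m h, map_smul,
        LinearMap.smul_apply, hh3, smul_eq_mul]
      push_cast
      ring
    rw [htop] at hindex
    have : Subsingleton (N ⧸ (⊤ : Submodule ℤ N)) := inferInstance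
    rw [Nat.card_of_subsingleton (0 : N ⧸ (⊤ : Submodule ℤ N))] at hindex
    omega
  obtain ⟨a, b, hab⟩ : ∃ a b : ℤ, a * κ x + b * 3 = 1 := by
    have : κ x % 3 = 1 ∨ κ x % 3 = 2 := by omega
    rcases this with h1 | h2
    · exact ⟨1, -(κ x / 3), by omega⟩
    · exact ⟨-1, κ x / 3 + 1, by omega⟩
  exact ⟨a • x + b • ⟨h, hhN⟩, by rwa [map_add, map_smul, map_smul, hκh]⟩

theorem map_eq_or_eq_neg_of_extends
    (hsymm : ∀ x y, B x y = B y x) (hnd : ∀ x : V, (∀ y : V, B x y = 0) → x = 0)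
    (hNspan : Submodule.span ℚ (N : Set V) = ⊤)
    (hhN : h ∈ N) (hh3 : B h h = 3) (hN₀ : ∀ x : V, x ∈ N₀ ↔ x ∈ N ∧ B x h = 0)
    {κ : N →ₗ[ℤ] ℤ} {p : N →ₗ[ℤ] N₀} (hκ : ∀ x : N, B (x : V) h = κ x)
    (hp : ∀ x : N, (p x : V) = (3 : ℚ) • (x : V) - (κ x : ℚ) • h)
    (f₀ : N₀ ≃ₗ[ℤ] N₀) (f : N ≃ₗ[ℤ] N)
    (hf : ∀ x y : N, B (f x : V) (f y : V) = B (x : V) (y : V))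
    (hext : ∀ x : N₀, ((f ⟨(x : V), ((hN₀ x).mp x.2).1⟩ : N) : V) = (f₀ x : V)) :
    (f ⟨h, hhN⟩ : V) = h ∨ (f ⟨h, hhN⟩ : V) = -h := by
  set w := f ⟨h, hhN⟩
  have horth : ∀ y ∈ N₀, B (w : V) y = 0 := fun y hy => by
    obtain ⟨z, hz⟩ := f₀.surjective ⟨y, hy⟩
    have h1 := hext z
    rw [hz] at h1
    rw [show y = _ from h1.symm, hf, hsymm]
    exact ((hN₀ z).1 z.2).2
  have h0 : (3 : ℚ) • (w : V) - (κ w : ℚ) • h = 0 := by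
    refine eq_zero_of_orthogonal_hyperplane hnd hNspan hp (fun y hy => ?_) ?_
    · simp [horth y hy, hsymm h y, ((hN₀ y).1 hy).2]
    · simp only [map_sub, map_smul, LinearMap.sub_apply, LinearMap.smul_apply, hκ, hh3, smul_eq_mul]
      ring
  have hww : B (w : V) (w : V) = 3 := (hf _ _).trans hh3
  have hw : (w : V) = ((κ w : ℚ) / 3) • h := by
    linear_combination (norm := module) (1 / 3 : ℚ) • h0
  have hsq : ((κ w : ℚ) / 3) * ((κ w : ℚ) / 3) = 1 := by
    rw [hw] at hww
    simp only [map_smul, LinearMap.smul_apply, hh3, smul_eq_mul] at hww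
    linarith
  rcases mul_self_eq_one_iff.1 hsq with h1 | h1
  · left; rw [hw, h1, one_smul]
  · right; rw [hw, h1, neg_one_smul]

theorem three_smul_map_of_extends (hhN : h ∈ N) (hN₀ : ∀ x : V, x ∈ N₀ ↔ x ∈ N ∧ B x h = 0)
    {κ : N →ₗ[ℤ] ℤ} {p : N →ₗ[ℤ] N₀}
    (hp : ∀ x : N, (p x : V) = (3 : ℚ) • (x : V) - (κ x : ℚ) • h)
    (f₀ : N₀ ≃ₗ[ℤ] N₀) (f : N ≃ₗ[ℤ] N)
    (hext : ∀ x : N₀, ((f ⟨(x : V), ((hN₀ x).mp x.2).1⟩ : N) : V) = (f₀ x : V)) (x : N) :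
    (3 : ℚ) • (f x : V) = (f₀ (p x) : V) + (κ x : ℚ) • (f ⟨h, hhN⟩ : V) := by
  have hx : (3 : ℤ) • x = ⟨(p x : V), ((hN₀ _).mp (p x).2).1⟩ + κ x • ⟨h, hhN⟩ := by
    ext
    simp only [Submodule.coe_add, Submodule.coe_smul, hp]
    module
  have h1 := congrArg (fun y => (f y : V)) hx
  simp only [map_add, map_smul, Submodule.coe_add, Submodule.coe_smul, hext] at h1
  simpa only [← Int.cast_smul_eq_zsmul ℚ, Int.cast_ofNat] using h1

theorem extension_eq
    (hNint : ∀ x ∈ N, ∀ y ∈ N, ∃ n : ℤ, B x y = (n : ℚ))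
    (hhN : h ∈ N) (hh3 : B h h = 3) (hN₀ : ∀ x : V, x ∈ N₀ ↔ x ∈ N ∧ B x h = 0)
    {κ : N →ₗ[ℤ] ℤ} {p : N →ₗ[ℤ] N₀}
    (hp : ∀ x : N, (p x : V) = (3 : ℚ) • (x : V) - (κ x : ℚ) • h)
    {u : N} (hu : κ u = 1) (f₀ : N₀ ≃ₗ[ℤ] N₀) (f f' : N ≃ₗ[ℤ] N)
    (hext : ∀ x : N₀, ((f ⟨(x : V), ((hN₀ x).mp x.2).1⟩ : N) : V) = (f₀ x : V))
    (hext' : ∀ x : N₀, ((f' ⟨(x : V), ((hN₀ x).mp x.2).1⟩ : N) : V) = (f₀ x : V))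
    (hh : (f ⟨h, hhN⟩ : V) = h ∨ (f ⟨h, hhN⟩ : V) = -h)
    (hh' : (f' ⟨h, hhN⟩ : V) = h ∨ (f' ⟨h, hhN⟩ : V) = -h) : f = f' := by
  have key := three_smul_map_of_extends hhN hN₀ hp f₀ f hext
  have key' := three_smul_map_of_extends hhN hN₀ hp f₀ f' hext'
  have hne (c : ℚ) (hc : c * c = 4) :
      (3 : ℚ) • (f u : V) - (3 : ℚ) • (f' u : V) ≠ c • h := fun heq => by
    obtain ⟨n, hn⟩ := hNint _ (N.sub_mem (f u).2 (f' u).2) _ (N.sub_mem (f u).2 (f' u).2)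
    have hv : (f u : V) - (f' u : V) = (c / 3) • h := by
      linear_combination (norm := module) (1 / 3 : ℚ) • heq
    rw [hv] at hn
    simp only [map_smul, LinearMap.smul_apply, hh3, smul_eq_mul] at hn
    have h4 : (3 : ℚ) * n = 4 := by linarith
    have h5 : (3 : ℤ) * n = 4 := by exact_mod_cast h4
    omega
  have hfh : (f ⟨h, hhN⟩ : V) = (f' ⟨h, hhN⟩ : V) := by
    rcases hh with h1 | h1 <;> rcases hh' with h2 | h2
    · rw [h1, h2]
    · refine (hne 2 (by norm_num) ?_).elim
      rw [key, key', h1, h2, hu]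
      module
    · refine (hne (-2) (by norm_num) ?_).elim
      rw [key, key', h1, h2, hu]
      module
    · rw [h1, h2]
  ext x
  have h1 : (3 : ℚ) • (f x : V) = (3 : ℚ) • (f' x : V) := by rw [key, key', hfh]
  exact smul_right_injective V (by norm_num : (3 : ℚ) ≠ 0) h1

/-- The glue vector `u - h/3` and its transform under `f₀` agree modulo `h^⊥` up to sign. -/
theorem exists_sign_glue
    (hsymm : ∀ x y, B x y = B y x)
    (hNint : ∀ x ∈ N, ∀ y ∈ N, ∃ n : ℤ, B x y = (n : ℚ))
    (hh3 : B h h = 3) (hN₀ : ∀ x : V, x ∈ N₀ ↔ x ∈ N ∧ B x h = 0)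
    {κ : N →ₗ[ℤ] ℤ} {p : N →ₗ[ℤ] N₀}
    (hp : ∀ x : N, (p x : V) = (3 : ℚ) • (x : V) - (κ x : ℚ) • h)
    {u : N} (hu : κ u = 1) {g : V}
    (hg_gen : ∀ x : V,
      (x ∈ Submodule.span ℚ (N₀ : Set V) ∧ ∀ y ∈ N₀, ∃ n : ℤ, B x y = (n : ℚ)) →
      (3 : ℤ) • x ∈ N₀ → (x ∈ N₀ ∨ x - g ∈ N₀ ∨ x + g ∈ N₀))
    (f₀ : N₀ ≃ₗ[ℤ] N₀)
    (hf₀ : ∀ x y : N₀, B (f₀ x : V) (f₀ y : V) = B (x : V) (y : V)) :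
    ∃ ε : ℤ, ε * ε = 1 ∧
      (1 / 3 : ℚ) • (f₀ (p u) : V) - ε • ((1 / 3 : ℚ) • (p u : V)) ∈ N₀ := by
  have hthree (v : V) : (3 : ℤ) • ((1 / 3 : ℚ) • v) = v := by module
  have hmem (w : N₀) : (1 / 3 : ℚ) • (w : V) ∈ Submodule.span ℚ (N₀ : Set V) :=
    Submodule.smul_mem _ _ (Submodule.subset_span w.2)
  have hpu : (1 / 3 : ℚ) • (p u : V) = u - (1 / 3 : ℚ) • h := by
    rw [hp, hu]
    module
  have hint : ∀ y ∈ N₀, ∃ n : ℤ, B ((1 / 3 : ℚ) • (p u : V)) y = (n : ℚ) := fun y hy => by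
    obtain ⟨n, hn⟩ := hNint u u.2 y ((hN₀ y).1 hy).1
    refine ⟨n, ?_⟩
    rw [hpu, map_sub, map_smul, LinearMap.sub_apply, LinearMap.smul_apply, hn, hsymm h y,
      ((hN₀ y).1 hy).2, smul_zero, sub_zero]
  have hnot : (1 / 3 : ℚ) • (p u : V) ∉ N₀ := fun hin => by
    have h1 : (1 / 3 : ℚ) • h ∈ N := by
      convert N.sub_mem u.2 ((hN₀ _).1 hin).1 using 1
      rw [hpu]
      module
    obtain ⟨n, hn⟩ := hNint _ h1 _ h1
    simp only [map_smul, LinearMap.smul_apply, hh3, smul_eq_mul] at hn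
    have h2 : (3 : ℚ) * n = 1 := by linarith
    have h3 : (3 : ℤ) * n = 1 := by exact_mod_cast h2
    omega
  refine exists_sign_sub_mem (g := g) hnot (fun hin => hnot ?_)
    (hg_gen _ ⟨hmem _, hint⟩ (by rw [hthree]; exact (p u).2))
    (hg_gen _ ⟨hmem _, fun y hy => ?_⟩ (by rw [hthree]; exact (f₀ (p u)).2))
  · obtain ⟨m, hm⟩ := f₀.surjective ⟨_, hin⟩
    have h1 : f₀ (p u) = f₀ ((3 : ℤ) • m) := by
      ext
      rw [map_smul, hm, Submodule.coe_smul, hthree]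
    rw [f₀.injective h1, Submodule.coe_smul]
    convert m.2 using 1
    module
  · obtain ⟨z, hz⟩ := f₀.surjective ⟨y, hy⟩
    obtain ⟨n, hn⟩ := hint z z.2
    refine ⟨n, ?_⟩
    rw [← hn, show y = f₀ z from congrArg Subtype.val hz.symm]
    simp only [map_smul, LinearMap.smul_apply, hf₀]

theorem exists_isometry_extension
    (hsymm : ∀ x y, B x y = B y x) (hnd : ∀ x : V, (∀ y : V, B x y = 0) → x = 0)
    (hNspan : Submodule.span ℚ (N : Set V) = ⊤)
    (hhN : h ∈ N) (hh3 : B h h = 3) (hN₀ : ∀ x : V, x ∈ N₀ ↔ x ∈ N ∧ B x h = 0)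
    {κ : N →ₗ[ℤ] ℤ} {p : N →ₗ[ℤ] N₀} (hκ : ∀ x : N, B (x : V) h = κ x)
    (hp : ∀ x : N, (p x : V) = (3 : ℚ) • (x : V) - (κ x : ℚ) • h)
    {u : N} (hu : κ u = 1) (f₀ : N₀ ≃ₗ[ℤ] N₀)
    (hf₀ : ∀ x y : N₀, B (f₀ x : V) (f₀ y : V) = B (x : V) (y : V))
    {ε : ℤ} (hε : ε * ε = 1)
    (hglue : (1 / 3 : ℚ) • (f₀ (p u) : V) - ε • ((1 / 3 : ℚ) • (p u : V)) ∈ N₀) :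
    ∃ f : N ≃ₗ[ℤ] N, (∀ x y : N, B (f x : V) (f y : V) = B (x : V) (y : V)) ∧
      ∀ x : N₀, ((f ⟨(x : V), ((hN₀ x).mp x.2).1⟩ : N) : V) = (f₀ x : V) := by
  have hεq : (ε : ℚ) * ε = 1 := by exact_mod_cast hε
  have hN₀N : N₀ ≤ N := fun x hx => ((hN₀ x).1 hx).1
  have hu' : (1 / 3 : ℚ) • ((f₀ (p u) : V) + (ε : ℚ) • h) ∈ N := by
    convert N.add_mem (hN₀N hglue) (N.smul_mem ε u.2) using 1
    rw [hp u, hu]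
    module
  set u' : N := ⟨_, hu'⟩ with hu'_def
  have hres (x : N) : (x : V) - κ x • (u : V) ∈ N₀ := by
    refine (hN₀ _).2 ⟨N.sub_mem x.2 (N.smul_mem _ u.2), ?_⟩
    rw [← Int.cast_smul_eq_zsmul ℚ]
    simp [hκ, hu]
  let r : N →ₗ[ℤ] N₀ := LinearMap.codRestrict N₀ (N.subtype - κ.smulRight (u : V)) hres
  have hr (x : N) : (r x : V) = x - κ x • (u : V) := rfl
  let F : N →ₗ[ℤ] N := Submodule.inclusion hN₀N ∘ₗ f₀.toLinearMap ∘ₗ r + κ.smulRight u'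
  have hF (x : N) : (F x : V) = (f₀ (r x) : V) + κ x • (u' : V) := rfl
  have hF3 (x : N) : (F x : V) = (1 / 3 : ℚ) • ((f₀ (p x) : V) + (κ x * ε : ℚ) • h) := by
    have h1 : p x = (3 : ℤ) • r x + κ x • p u := by
      ext
      simp only [Submodule.coe_add, Submodule.coe_smul, hp, hr, hu]
      module
    rw [hF, h1, map_add, map_smul, map_smul, Submodule.coe_add, Submodule.coe_smul,
      Submodule.coe_smul]
    module
  have hperp (y : N₀) : B (y : V) h = 0 := ((hN₀ y).1 y.2).2
  have hiso (x y : N) : B (F x : V) (F y : V) = B (x : V) (y : V) := by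
    have hxy := hf₀ (p x) (p y)
    rw [hp x, hp y] at hxy
    have hyh := hsymm h y
    simp only [map_sub, map_smul, LinearMap.sub_apply, LinearMap.smul_apply, hκ, hh3,
      smul_eq_mul, hyh] at hxy
    rw [hF3, hF3]
    simp only [map_add, map_smul, LinearMap.add_apply, LinearMap.smul_apply, hh3, hperp,
      hsymm h (f₀ _ : V), smul_eq_mul]
    linear_combination (1 / 9) * hxy + (1 / 3) * (κ x * κ y : ℚ) * hεq
  have hκN₀ (x : N₀) : κ ⟨x, hN₀N x.2⟩ = 0 := by
    have h1 := hκ ⟨x, hN₀N x.2⟩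
    rw [hperp] at h1
    exact_mod_cast h1.symm
  have hext (x : N₀) : (F ⟨x, hN₀N x.2⟩ : V) = f₀ x := by
    have h1 : r ⟨x, hN₀N x.2⟩ = x := by
      ext
      rw [hr, hκN₀, zero_smul, sub_zero]
    rw [hF, h1, hκN₀, zero_smul, add_zero]
  have hinj : Function.Injective F := by
    refine (injective_iff_map_eq_zero F).2 fun x hx => Subtype.ext ?_
    have h0 (y : N) : B (x : V) (y : V) = 0 := by rw [← hiso, hx]; simp
    exact eq_zero_of_orthogonal_hyperplane hnd hNspan hp
      (fun y hy => h0 ⟨y, hN₀N hy⟩) (h0 ⟨h, hhN⟩)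
  have hκu' : κ u' = ε := by
    have h1 := hκ u'
    rw [hu'_def] at h1
    simp only [map_add, map_smul, LinearMap.add_apply, LinearMap.smul_apply, hh3, hperp,
      smul_eq_mul] at h1
    have h2 : (κ u' : ℚ) = ε := by rw [← h1]; ring
    exact_mod_cast h2
  have hFu : F u = u' := by
    have h1 : r u = 0 := by
      ext
      rw [hr, hu, one_smul, sub_self, Submodule.coe_zero]
    ext
    rw [hF, h1, hu, map_zero, one_smul, Submodule.coe_zero, zero_add]
  have hsurj : Function.Surjective F := fun y => by
    have hy : ((y - (κ y * ε) • u' : N) : V) ∈ N₀ := by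
      refine (hN₀ _).2 ⟨Subtype.property _, ?_⟩
      rw [hκ, map_sub, map_smul, hκu', smul_eq_mul, mul_assoc, hε, mul_one, sub_self, Int.cast_zero]
    obtain ⟨m, hm⟩ := f₀.surjective ⟨_, hy⟩
    refine ⟨⟨m, hN₀N m.2⟩ + (κ y * ε) • u, ?_⟩
    ext
    rw [map_add, map_smul, hFu, Submodule.coe_add, hext, hm]
    simp
  exact ⟨LinearEquiv.ofBijective F ⟨hinj, hsurj⟩, hiso, hext⟩

end HyperplaneSection

/-- Extension of isometries from `N₀ = h^⊥` to `N`, where `h·h = 3`,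
`N₀ + ℤh` has index `3` in `N`, and the `3`-torsion of the discriminant group
`N₀*/N₀` is cyclic of order `3` (witnessed by `g`).  The lattice `N` is
presented as a finitely generated full `ℤ`-submodule of a rational vector
space `V` carrying a nondegenerate symmetric bilinear form that is
integer-valued on `N`; then `N₀ ⊗ ℚ = spanℚ N₀` and
`N₀* = {x ∈ spanℚ N₀ : B x N₀ ⊆ ℤ}`.  Every isometry `f₀` of `N₀` extends
uniquely to an isometry `f` of `N`, and the extension sends `h` to `h` or to
`−h`. -/
theorem isometry_extends_uniquely
    {V : Type*} [AddCommGroup V] [Module ℚ V] [FiniteDimensional ℚ V]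
    (B : V →ₗ[ℚ] V →ₗ[ℚ] ℚ)
    (hsymm : ∀ x y, B x y = B y x)
    (hnd : ∀ x : V, (∀ y : V, B x y = 0) → x = 0)
    (N : Submodule ℤ V) (hNfg : N.FG)
    (hNspan : Submodule.span ℚ (N : Set V) = ⊤)
    (hNint : ∀ x ∈ N, ∀ y ∈ N, ∃ n : ℤ, B x y = (n : ℚ))
    (h : V) (hhN : h ∈ N) (hh3 : B h h = 3)
    (N₀ : Submodule ℤ V)
    (hN₀ : ∀ x : V, x ∈ N₀ ↔ x ∈ N ∧ B x h = 0)
    -- `N₀ + ℤh` has index `3` in `N`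
    (hindex : Nat.card
      (N ⧸ (Submodule.comap N.subtype (N₀ ⊔ Submodule.span ℤ {h}))) = 3)
    -- the `3`-torsion subgroup of `N₀*/N₀` is cyclic of order `3`,
    -- generated by the class of `g ∈ N₀*`
    (g : V)
    (hg_dual : g ∈ Submodule.span ℚ (N₀ : Set V) ∧
      ∀ y ∈ N₀, ∃ n : ℤ, B g y = (n : ℚ))
    (hg_tor : (3 : ℤ) • g ∈ N₀) (hg_ne : g ∉ N₀)
    (hg_gen : ∀ x : V,
      (x ∈ Submodule.span ℚ (N₀ : Set V) ∧ ∀ y ∈ N₀, ∃ n : ℤ, B x y = (n : ℚ)) →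
      (3 : ℤ) • x ∈ N₀ → (x ∈ N₀ ∨ x - g ∈ N₀ ∨ x + g ∈ N₀))
    (f₀ : N₀ ≃ₗ[ℤ] N₀)
    (hf₀ : ∀ x y : N₀, B (f₀ x : V) (f₀ y : V) = B (x : V) (y : V)) :
    (∃! f : N ≃ₗ[ℤ] N,
      (∀ x y : N, B (f x : V) (f y : V) = B (x : V) (y : V)) ∧
      (∀ x : N₀, ((f ⟨(x : V), ((hN₀ x).mp x.2).1⟩ : N) : V) = (f₀ x : V))) ∧
    (∀ f : N ≃ₗ[ℤ] N,
      ((∀ x y : N, B (f x : V) (f y : V) = B (x : V) (y : V)) ∧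
       (∀ x : N₀, ((f ⟨(x : V), ((hN₀ x).mp x.2).1⟩ : N) : V) = (f₀ x : V))) →
      ((f ⟨h, hhN⟩ : V) = h ∨ (f ⟨h, hhN⟩ : V) = -h)) := by
  obtain ⟨κ, p, hκ, hp⟩ := exists_pairing_and_projection hNint hhN hh3 hN₀
  obtain ⟨u, hu⟩ := exists_pairing_eq_one hhN hh3 hN₀ hindex hκ
  obtain ⟨ε, hε, hglue⟩ := exists_sign_glue hsymm hNint hh3 hN₀ hp hu hg_gen f₀ hf₀
  obtain ⟨f, hf, hext⟩ := exists_isometry_extension hsymm hnd hNspan hhN hh3 hN₀ hκ hp hu f₀ hf₀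
    hε hglue
  have hsign (f : N ≃ₗ[ℤ] N) :=
    map_eq_or_eq_neg_of_extends hsymm hnd hNspan hhN hh3 hN₀ hκ hp f₀ f
  exact ⟨⟨f, ⟨hf, hext⟩, fun f' hf' => extension_eq hNint hhN hh3 hN₀ hp hu f₀ f' f hf'.2 hext
    (hsign f' hf'.1 hf'.2) (hsign f hf hext)⟩, fun f hf => hsign f hf.1 hf.2⟩
end

section
/- Let L be a lattice, v ∈ L with v·v = 2, w₀ ∈ L with w₀·v = 0, and k a nonzero integer; set w = w₀ + k·v. If either w·w = 2, or w·w = 6 and 3 divides w·x for every x ∈ L, then w₀·w₀ ≤ 0. -/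
/-- Let `v` be a vector of square `2` in a lattice `L`, `w₀ ⟂ v`, `k ≠ 0`, and
`w = w₀ + k • v`. If `w` is a `2`-root, or a `6`-root (square `6` with all
products divisible by `3`), then `w₀·w₀ ≤ 0`. -/
theorem orthogonal_component_nonpos
    {L : Type*} [AddCommGroup L] [Module ℤ L]
    [Module.Free ℤ L] [Module.Finite ℤ L]
    (B : L →ₗ[ℤ] L →ₗ[ℤ] ℤ)
    (hsymm : ∀ x y, B x y = B y x)
    (hnd : ∀ x, (∀ y, B x y = 0) → x = 0)
    (v w₀ : L) (hv : B v v = 2) (hw₀v : B w₀ v = 0)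
    (k : ℤ) (hk : k ≠ 0)
    (hroot : B (w₀ + k • v) (w₀ + k • v) = 2 ∨
      (B (w₀ + k • v) (w₀ + k • v) = 6 ∧
        ∀ x : L, (3 : ℤ) ∣ B (w₀ + k • v) x)) :
    B w₀ w₀ ≤ 0 := by
  have hw : B (w₀ + k • v) (w₀ + k • v) = B w₀ w₀ + 2 * k ^ 2 := by
    simp only [map_add, map_zsmul, LinearMap.add_apply, LinearMap.smul_apply, smul_eq_mul,
      hsymm v w₀, hw₀v, hv]
    ring
  rw [hw] at hroot
  rcases hroot with h | ⟨h, hdvd⟩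
  · nlinarith [Int.one_le_abs hk, sq_abs k]
  · have h3 : (3 : ℤ) ∣ k := by
      have hwv := hdvd v
      simp only [map_add, map_zsmul, LinearMap.add_apply, LinearMap.smul_apply, smul_eq_mul,
        hw₀v, hv] at hwv
      lia
    obtain ⟨m, rfl⟩ := h3
    have hm : m ≠ 0 := right_ne_zero_of_mul hk
    nlinarith [Int.one_le_abs hm, sq_abs m]
end

section
/- Let L be a lattice such that 2x ∈ L for every x ∈ L ⊗ ℚ with x·y ∈ ℤ for all y ∈ L (that is, the discriminant group of L is 2-periodic). Then L contains no 6-root: there is no v ∈ L with v·v = 6 such that 3 divides v·x for every x ∈ L. -/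
/-- A lattice whose discriminant group is `2`-periodic has no `6`-roots.
The lattice `N` is presented as a finitely generated full `ℤ`-submodule of a
rational vector space `V` carrying a nondegenerate symmetric bilinear form
which is integer-valued on `N`; `2`-periodicity of the discriminant says that
`2x ∈ N` for every `x ∈ V = N ⊗ ℚ` pairing integrally with all of `N`. -/
theorem no_six_roots_of_two_periodic_discriminant
    {V : Type*} [AddCommGroup V] [Module ℚ V] [FiniteDimensional ℚ V]
    (B : V →ₗ[ℚ] V →ₗ[ℚ] ℚ)
    (hsymm : ∀ x y, B x y = B y x)
    (hnd : ∀ x : V, (∀ y : V, B x y = 0) → x = 0)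
    (N : Submodule ℤ V) (hNfg : N.FG)
    (hNspan : Submodule.span ℚ (N : Set V) = ⊤)
    (hNint : ∀ x ∈ N, ∀ y ∈ N, ∃ n : ℤ, B x y = (n : ℚ))
    (h2per : ∀ x : V, (∀ y ∈ N, ∃ n : ℤ, B x y = (n : ℚ)) → (2 : ℤ) • x ∈ N) :
    ¬ ∃ v ∈ N, B v v = 6 ∧ ∀ x ∈ N, ∃ n : ℤ, B v x = ((3 * n : ℤ) : ℚ) := by
  rintro ⟨v, -, hvv, hv⟩
  have hmem : (2 : ℤ) • ((1 / 3 : ℚ) • v) ∈ N := by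
    refine h2per _ fun y hy => ?_
    obtain ⟨n, hn⟩ := hv y hy
    refine ⟨n, ?_⟩
    rw [map_smul, LinearMap.smul_apply, hn, smul_eq_mul]
    push_cast
    ring
  obtain ⟨n, hn⟩ := hv _ hmem
  rw [map_zsmul, map_smul, hvv, smul_eq_mul, zsmul_eq_mul] at hn
  have h : (4 : ℚ) = ((3 * n : ℤ) : ℚ) := by
    rw [← hn]
    norm_num
  have h' : (4 : ℤ) = 3 * n := by exact_mod_cast h
  omega
end

section
/- Let V be a finite-dimensional real vector space with a symmetric bilinear form B, and assume that every subspace of V on which B is negative definite has dimension at most 2. If P₁ and P₂ are 2-dimensional subspaces of V on which B is negative definite, then for every nonzero x ∈ P₁ there exists y ∈ P₂ with B(x, y) ≠ 0; consequently the B-orthogonal projection of P₁ to P₂ is a linear isomorphism. -/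
/-- Adjoining a vector on which `B` is negative and which is `B`-orthogonal to a negative definite
subspace gives a negative definite subspace. -/
lemma negDef_sup_span_singleton {V : Type*} [AddCommGroup V] [Module ℝ V]
    (B : V →ₗ[ℝ] V →ₗ[ℝ] ℝ) (hsymm : ∀ x y, B x y = B y x) {P : Submodule ℝ V}
    (hP : ∀ w ∈ P, w ≠ 0 → B w w < 0) {x : V} (hx : B x x < 0) (hxP : ∀ y ∈ P, B x y = 0) :
    ∀ w ∈ P ⊔ Submodule.span ℝ {x}, w ≠ 0 → B w w < 0 := by
  intro w hw hw0
  obtain ⟨p, hp, z, hz, rfl⟩ := Submodule.mem_sup.mp hw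
  obtain ⟨c, rfl⟩ := Submodule.mem_span_singleton.mp hz
  have hexp : B (p + c • x) (p + c • x) = B p p + c ^ 2 * B x x := by
    simp only [map_add, map_smul, LinearMap.add_apply, LinearMap.smul_apply, smul_eq_mul,
      hsymm p x, hxP p hp]
    ring
  rw [hexp]
  by_cases hp0 : p = 0
  · have hc : c ≠ 0 := by
      rintro rfl
      simp [hp0] at hw0
    have := mul_neg_of_pos_of_neg (sq_pos_of_ne_zero hc) hx
    simpa [hp0] using this
  · exact add_neg_of_neg_of_nonpos (hP p hp hp0)
      (mul_nonpos_of_nonneg_of_nonpos (sq_nonneg c) hx.le)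

/-- The `B`-orthogonal projection onto a finite-dimensional negative definite subspace exists. -/
lemma exists_orthogonal_projection_of_negDef {V : Type*} [AddCommGroup V] [Module ℝ V]
    (B : V →ₗ[ℝ] V →ₗ[ℝ] ℝ) (P : Submodule ℝ V) [FiniteDimensional ℝ P]
    (hP : ∀ w ∈ P, w ≠ 0 → B w w < 0) :
    ∃ π : V →ₗ[ℝ] P, ∀ x : V, ∀ y ∈ P, B (x - (π x : V)) y = 0 := by
  let R : V →ₗ[ℝ] Module.Dual ℝ P := P.subtype.dualMap ∘ₗ B
  have hinj : Function.Injective (R ∘ₗ P.subtype) := by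
    refine (injective_iff_map_eq_zero _).mpr fun p hp => ?_
    by_contra hp0
    have hzero : B p p = 0 := LinearMap.congr_fun hp p
    exact (hP p p.2 (by simpa using hp0)).ne hzero
  let D : P ≃ₗ[ℝ] Module.Dual ℝ P :=
    LinearMap.linearEquivOfInjective (R ∘ₗ P.subtype) hinj Subspace.dual_finrank_eq.symm
  refine ⟨D.symm.toLinearMap ∘ₗ R, fun x y hy => ?_⟩
  have h : B (D.symm (R x) : V) y = B x y :=
    LinearMap.congr_fun (D.apply_symm_apply (R x)) ⟨y, hy⟩
  simp [h]

/-- If every negative definite subspace of `(V, B)` has dimension at most `2`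
and `P₁, P₂` are negative definite planes, then no nonzero vector of `P₁` is
`B`-orthogonal to all of `P₂`; consequently the `B`-orthogonal projection of
`P₁` to `P₂` (the unique linear map `π : P₁ → P₂` with `x − π x ⟂ P₂`) is a
linear isomorphism. -/
theorem negdef_plane_projection_bijective
    {V : Type*} [AddCommGroup V] [Module ℝ V] [FiniteDimensional ℝ V]
    (B : V →ₗ[ℝ] V →ₗ[ℝ] ℝ)
    (hsymm : ∀ x y, B x y = B y x)
    (hdim : ∀ W : Submodule ℝ V,
      (∀ w ∈ W, w ≠ 0 → B w w < 0) → Module.finrank ℝ W ≤ 2)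
    (P₁ P₂ : Submodule ℝ V)
    (hP₁rank : Module.finrank ℝ P₁ = 2) (hP₂rank : Module.finrank ℝ P₂ = 2)
    (hP₁neg : ∀ w ∈ P₁, w ≠ 0 → B w w < 0)
    (hP₂neg : ∀ w ∈ P₂, w ≠ 0 → B w w < 0) :
    (∀ x ∈ P₁, x ≠ 0 → ∃ y ∈ P₂, B x y ≠ 0) ∧
    ∃ π : P₁ →ₗ[ℝ] P₂,
      (∀ x : P₁, ∀ y ∈ P₂, B ((x : V) - (π x : V)) y = 0) ∧
      Function.Bijective π := by
  have hpair : ∀ x ∈ P₁, x ≠ 0 → ∃ y ∈ P₂, B x y ≠ 0 := by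
    intro x hx hx0
    by_contra! hort
    have hxx := hP₁neg x hx hx0
    have hlt : P₂ < P₂ ⊔ Submodule.span ℝ {x} := by
      refine lt_of_le_not_ge le_sup_left fun hle => hxx.ne (hort x (hle ?_))
      exact Submodule.mem_sup_right (Submodule.mem_span_singleton_self x)
    have hrank := Submodule.finrank_lt_finrank_of_lt hlt
    have := hdim _ (negDef_sup_span_singleton B hsymm hP₂neg hxx hort)
    omega
  obtain ⟨π, hπ⟩ := exists_orthogonal_projection_of_negDef B P₂ hP₂neg
  refine ⟨hpair, π ∘ₗ P₁.subtype, fun x => hπ x, ?_⟩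
  have hinj : Function.Injective (π ∘ₗ P₁.subtype) := by
    refine (injective_iff_map_eq_zero _).mpr fun x hx => ?_
    by_contra hx0
    obtain ⟨y, hy, hxy⟩ := hpair x x.2 (by simpa using hx0)
    have hx' : π (x : V) = 0 := hx
    exact hxy (by simpa [hx'] using hπ x y hy)
  exact ⟨hinj, (LinearMap.injective_iff_surjective_of_finrank_eq_finrank
    (hP₁rank.trans hP₂rank.symm)).mp hinj⟩
end
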